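/- arXiv:2508.05789 — 3 statements merged into one kernel-verified Lean document; each statement's English description precedes it below -/
import Mathlib

section
/- For every integer k ≥ 1, the charge Q_M^{(k)} commutes with the Hamiltonian: H_M · Q_M^{(k)} = Q_M^{(k)} · H_M. -/
namespace FFD

variable {A : Type*} [Ring A] [Algebra ℂ A]

/-- Index pattern for which the extra generator `ħ_{2m+1}` (with parameter `m`)
anticommutes with the plain generator `h l`. -/
def MixedRel (m l : ℤ) : Prop :=
  l = 2 * m - 5 ∨ l = 2 * m - 3 ∨ l = 2 * m - 1 ∨ l = 2 * m + 1 ∨ l = 2 * m ∨ l = 2 * m + 2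

/-- Vertex codes of the frustration graph: the even code `2 * i` encodes the plain vertex `i`
(generator `h i`), the odd code `2 * m + 1` encodes the barred vertex `2m+1` (generator
`ħ_{2m+1}`).  Two codes are adjacent exactly when the corresponding generators anticommute. -/
def Adj (v w : ℕ) : Prop :=
  if v % 2 = 0 then
    if w % 2 = 0 then
      1 ≤ |((v / 2 : ℕ) : ℤ) - ((w / 2 : ℕ) : ℤ)| ∧
        |((v / 2 : ℕ) : ℤ) - ((w / 2 : ℕ) : ℤ)| ≤ 2
    else MixedRel ((w / 2 : ℕ) : ℤ) ((v / 2 : ℕ) : ℤ)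
  else
    if w % 2 = 0 then MixedRel ((v / 2 : ℕ) : ℤ) ((w / 2 : ℕ) : ℤ)
    else |((v / 2 : ℕ) : ℤ) - ((w / 2 : ℕ) : ℤ)| = 1

/-- The vertex set of the frustration graph `G n`: plain vertices `1, …, n` and barred
vertices `2m+1` for `0 ≤ m ≤ ⌊n/2⌋`. -/
def memG (n v : ℕ) : Prop :=
  if v % 2 = 0 then 1 ≤ v / 2 ∧ v / 2 ≤ n else v / 2 ≤ n / 2

/-- The generator attached to a vertex code. -/
def gen (h hb : ℤ → A) (v : ℕ) : A :=
  if v % 2 = 0 then h ((v / 2 : ℕ) : ℤ) else hb ((v / 2 : ℕ) : ℤ)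

/-- The product `h_S` of the generators of a set of vertex codes, taken in increasing order
of the codes (for an independent set the factors pairwise commute, so the order is
immaterial). -/
def prodGen (h hb : ℤ → A) (S : Finset ℕ) : A :=
  ((S.sort (· ≤ ·)).map (gen h hb)).prod

/-- The finite collection of all independent sets of cardinality `k` of `G n`. -/
noncomputable def indepSets (n k : ℕ) : Finset (Finset ℕ) :=
  @Finset.filter _
    (fun S => S.card = k ∧ (∀ v ∈ S, memG n v) ∧ ∀ v ∈ S, ∀ w ∈ S, v ≠ w → ¬Adj v w)
    (fun _ => Classical.propDecidable _)
    (Finset.range (2 * n + 2)).powerset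

/-- The charge `Q_n^{(k)}`, with the conventions `Q_n^{(0)} = 1`, `Q_n^{(k)} = 0` for `k < 0`,
and `Q_n^{(k)} = 0` for `n < 0`, `k > 0`. -/
noncomputable def Q (h hb : ℤ → A) (n k : ℤ) : A :=
  if k < 0 then 0
  else if n < 0 then (if k = 0 then 1 else 0)
  else ∑ S ∈ indepSets n.toNat k.toNat, prodGen h hb S

/-- The transfer matrix `T_n(u) = ∑_{k ≥ 0} (-u)^k Q_n^{(k)}` (a finite sum, since
`Q_n^{(k)} = 0` whenever `k` exceeds the number of vertices of `G n`), with `T_n(u) = 1`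
for `n ≤ 0`. -/
noncomputable def T (h hb : ℤ → A) (n : ℤ) (u : ℂ) : A :=
  if n ≤ 0 then 1
  else ∑ k ∈ Finset.range (2 * n.toNat + 3), (-u) ^ k • Q h hb n (k : ℤ)

/-- `A_{2m-1} = h_{2m} h_{2m-3} + h_{2m-2} ħ_{2m+1}`. -/
def AOp (h hb : ℤ → A) (m : ℤ) : A :=
  h (2 * m) * h (2 * m - 3) + h (2 * m - 2) * hb m

/-- `C_{2m} = h_{2m-3} ħ_{2m+3}`. -/
def COp (h hb : ℤ → A) (m : ℤ) : A := h (2 * m - 3) * hb (m + 1)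

/-- `𝕊_{2m} = h_{2m-1} + h_{2m} + ħ_{2m+1}`. -/
def SOp (h hb : ℤ → A) (m : ℤ) : A := h (2 * m - 1) + h (2 * m) + hb m

/-- The defining relations of the extended FFD algebra with generators `h_1, …, h_M` and
`ħ_{2m+1} = hb m` for `0 ≤ m ≤ ⌊M/2⌋`. -/
structure FFDHyp (M : ℤ) (h hb : ℤ → A) (b bb : ℤ → ℂ) : Prop where
  hsq : ∀ m, 1 ≤ m → m ≤ M → h m * h m = (b m) ^ 2 • (1 : A)
  hanti : ∀ m l, 1 ≤ m → m ≤ M → 1 ≤ l → l ≤ M → 1 ≤ |m - l| → |m - l| ≤ 2 →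
    h m * h l = -(h l * h m)
  hcomm : ∀ m l, 1 ≤ m → m ≤ M → 1 ≤ l → l ≤ M → 2 < |m - l| →
    h m * h l = h l * h m
  hbsq : ∀ m, 0 ≤ m → m ≤ M / 2 → hb m * hb m = (bb m) ^ 2 • (1 : A)
  hbanti : ∀ m l, 0 ≤ m → m ≤ M / 2 → 1 ≤ l → l ≤ M → MixedRel m l →
    hb m * h l = -(h l * hb m)
  hbcomm : ∀ m l, 0 ≤ m → m ≤ M / 2 → 1 ≤ l → l ≤ M → ¬MixedRel m l →
    hb m * h l = h l * hb m
  hbbanti : ∀ m m', 0 ≤ m → m ≤ M / 2 → 0 ≤ m' → m' ≤ M / 2 → |m - m'| = 1 →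
    hb m * hb m' = -(hb m' * hb m)
  hbbcomm : ∀ m m', 0 ≤ m → m ≤ M / 2 → 0 ≤ m' → m' ≤ M / 2 → m ≠ m' → |m - m'| ≠ 1 →
    hb m * hb m' = hb m' * hb m

/-- The extra relation `A_{2m-1} C_{2m+2} = C_{2m} A_{2m+3}` for all `1 < m < ⌊M/2⌋ - 1`. -/
def ACRel (M : ℤ) (h hb : ℤ → A) : Prop :=
  ∀ m : ℤ, 1 < m → m < M / 2 - 1 →
    AOp h hb m * COp h hb (m + 1) = COp h hb m * AOp h hb (m + 2)

/-- The assumption that the products around the even holes are the scalars `μ_{2m-1}`. -/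
def MuScalar (M : ℤ) (h hb : ℤ → A) (μ : ℤ → ℂ) : Prop :=
  ∀ m : ℤ, 1 < m → m ≤ M / 2 →
    h (2 * m - 3) * h (2 * m) * h (2 * m - 2) * hb m = μ m • (1 : A)

/-- The assumption that `𝕊_{2m}²`, `A_{2m-1}²`, `C_{2m}²` are the scalars `s_{2m}`,
`a_{2m-1}`, `c_{2m}` times the identity, the coefficients attached to generators of
non-positive index being set to zero. -/
structure ScalarSquares (M : ℤ) (h hb : ℤ → A) (s a c : ℤ → ℂ) : Prop where
  hs : ∀ m : ℤ, 1 ≤ m → 2 * m ≤ M → SOp h hb m * SOp h hb m = s (2 * m) • (1 : A)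
  hszero : ∀ m : ℤ, m ≤ 0 → s (2 * m) = 0
  ha : ∀ m : ℤ, 2 ≤ m → 2 * m ≤ M → AOp h hb m * AOp h hb m = a (2 * m - 1) • (1 : A)
  hazero : ∀ m : ℤ, m ≤ 1 → a (2 * m - 1) = 0
  hc : ∀ m : ℤ, 2 ≤ m → 2 * m + 2 ≤ M → COp h hb m * COp h hb m = c (2 * m) • (1 : A)
  hczero : ∀ m : ℤ, m ≤ 1 → c (2 * m) = 0

/-- The explicitly defined polynomial sequence `P_n(z)`:
`P_n = 1` for `n ≤ 0`, `P_{2m-1}(z) = P_{2m-2}(z) - b_{2m-1}² z P_{2m-4}(z)` and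
`P_{2m}(z) = P_{2m-2}(z) - s_{2m} z P_{2m-4}(z) + a_{2m-1} z² P_{2m-6}(z)
- c_{2m-2} z² P_{2m-8}(z)`. -/
structure PolyRec (b s a c : ℤ → ℂ) (P : ℤ → ℂ → ℂ) : Prop where
  base : ∀ n : ℤ, n ≤ 0 → ∀ z : ℂ, P n z = 1
  odd : ∀ m : ℤ, 1 ≤ m → ∀ z : ℂ, P (2 * m - 1) z =
    P (2 * m - 2) z - (b (2 * m - 1)) ^ 2 * z * P (2 * m - 4) z
  even : ∀ m : ℤ, 1 ≤ m → ∀ z : ℂ, P (2 * m) z =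
    P (2 * m - 2) z - s (2 * m) * z * P (2 * m - 4) z
      + a (2 * m - 1) * z ^ 2 * P (2 * m - 6) z
      - c (2 * m - 2) * z ^ 2 * P (2 * m - 8) z

/-- `r_M`: equal to `1` for odd `M` and to `2` for even `M`. -/
def rM (M : ℤ) : ℤ := if M % 2 = 1 then 1 else 2

/-- The sum `𝕊` of the generators of the right-end simplicial clique:
`h_M` for odd `M`, and `h_{M-1} + h_M + ħ_{M+1}` for even `M`. -/
def SEdge (M : ℤ) (h hb : ℤ → A) : A :=
  if M % 2 = 1 then h M else h (M - 1) + h M + hb (M / 2)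

/-- The right-end simplicial mode `χ`: it squares to `1`, anticommutes with the generators
of the right-end simplicial clique and commutes with all the other generators. -/
structure EdgeMode (M : ℤ) (h hb : ℤ → A) (χ : A) : Prop where
  sq : χ * χ = 1
  odd : M % 2 = 1 →
    (χ * h M = -(h M * χ)) ∧
    (∀ l : ℤ, 1 ≤ l → l < M → χ * h l = h l * χ) ∧
    (∀ m : ℤ, 0 ≤ m → m ≤ M / 2 → χ * hb m = hb m * χ)
  even : M % 2 = 0 →
    (χ * h (M - 1) = -(h (M - 1) * χ)) ∧
    (χ * h M = -(h M * χ)) ∧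
    (χ * hb (M / 2) = -(hb (M / 2) * χ)) ∧
    (∀ l : ℤ, 1 ≤ l → l ≤ M - 2 → χ * h l = h l * χ) ∧
    (∀ m : ℤ, 0 ≤ m → m < M / 2 → χ * hb m = hb m * χ)

theorem adj_iff (v w : ℕ) : Adj v w ↔
    (v % 2 = 0 ∧ w % 2 = 0 ∧ v ≠ w ∧ v ≤ w + 4 ∧ w ≤ v + 4) ∨
    (v % 2 = 1 ∧ w % 2 = 1 ∧ (v = w + 2 ∨ w = v + 2)) ∨
    (v % 2 = 0 ∧ w % 2 = 1 ∧ (v + 12 = 2 * w ∨ v + 8 = 2 * w ∨ v + 4 = 2 * w ∨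
      v + 2 = 2 * w ∨ v = 2 * w ∨ v = 2 * w + 2)) ∨
    (w % 2 = 0 ∧ v % 2 = 1 ∧ (w + 12 = 2 * v ∨ w + 8 = 2 * v ∨ w + 4 = 2 * v ∨
      w + 2 = 2 * v ∨ w = 2 * v ∨ w = 2 * v + 2)) := by
  unfold Adj MixedRel
  obtain h1 | h1 := Nat.mod_two_eq_zero_or_one v <;>
    obtain h2 | h2 := Nat.mod_two_eq_zero_or_one w <;>
    simp only [h1, h2, le_abs, abs_le, abs_eq zero_le_one, if_true, if_false, zero_ne_one,
      one_ne_zero, true_and, false_and, and_false, or_false, false_or] <;> omega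

theorem Adj.symm {v w : ℕ} (hvw : Adj v w) : Adj w v := by
  rw [adj_iff] at hvw ⊢
  rcases hvw with hvw | hvw | hvw | hvw
  · exact .inl ⟨hvw.2.1, hvw.1, hvw.2.2.1.symm, hvw.2.2.2.2, hvw.2.2.2.1⟩
  · exact .inr (.inl ⟨hvw.2.1, hvw.1, hvw.2.2.symm⟩)
  · exact .inr (.inr (.inr hvw))
  · exact .inr (.inr (.inl hvw))

theorem not_adj_self (v : ℕ) : ¬Adj v v := by
  rw [adj_iff]; omega

theorem gen_mul_gen_of_adj {M : ℤ} (hM : 0 ≤ M) {h hb : ℤ → A} {b bb : ℤ → ℂ}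
    (hyp : FFDHyp M h hb b bb) {v w : ℕ} (hv : memG M.toNat v) (hw : memG M.toNat w)
    (hvw : Adj v w) : gen h hb v * gen h hb w = -(gen h hb w * gen h hb v) := by
  unfold memG at hv hw
  unfold Adj at hvw
  unfold gen
  split_ifs at * with h1 h2 h2
  · exact hyp.hanti _ _ (by omega) (by omega) (by omega) (by omega) hvw.1 hvw.2
  · rw [hyp.hbanti _ _ (by omega) (by omega) (by omega) (by omega) hvw, neg_neg]
  · exact hyp.hbanti _ _ (by omega) (by omega) (by omega) (by omega) hvw
  · exact hyp.hbbanti _ _ (by omega) (by omega) (by omega) (by omega) hvw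

theorem commute_gen_gen_of_not_adj {M : ℤ} (hM : 0 ≤ M) {h hb : ℤ → A} {b bb : ℤ → ℂ}
    (hyp : FFDHyp M h hb b bb) {v w : ℕ} (hv : memG M.toNat v) (hw : memG M.toNat w)
    (hvw : ¬Adj v w) : Commute (gen h hb v) (gen h hb w) := by
  obtain rfl | hne := eq_or_ne v w
  · exact Commute.refl _
  unfold memG at hv hw
  unfold Adj at hvw
  unfold gen
  split_ifs at * with h1 h2 h2
  · refine hyp.hcomm _ _ (by omega) (by omega) (by omega) (by omega) ?_
    by_contra hle
    exact hvw ⟨by rw [le_abs]; omega, by omega⟩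
  · exact (hyp.hbcomm _ _ (by omega) (by omega) (by omega) (by omega) hvw).symm
  · exact hyp.hbcomm _ _ (by omega) (by omega) (by omega) (by omega) hvw
  · exact hyp.hbbcomm _ _ (by omega) (by omega) (by omega) (by omega) (by omega) hvw

/-- A set of vertex codes of `G n` no two of which are adjacent. -/
def IsIndep (n : ℕ) (S : Finset ℕ) : Prop :=
  (∀ v ∈ S, memG n v) ∧ ∀ v ∈ S, ∀ w ∈ S, v ≠ w → ¬Adj v w

theorem IsIndep.mono {n : ℕ} {S R : Finset ℕ} (hS : IsIndep n S) (hR : R ⊆ S) : IsIndep n R :=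
  ⟨fun v hv => hS.1 v (hR hv), fun v hv w hw => hS.2 v (hR hv) w (hR hw)⟩

theorem IsIndep.not_adj {n : ℕ} {S : Finset ℕ} (hS : IsIndep n S) {v w : ℕ} (hv : v ∈ S)
    (hw : w ∈ S) : ¬Adj v w := by
  obtain rfl | hne := eq_or_ne v w
  · exact not_adj_self v
  · exact hS.2 v hv w hw hne

theorem IsIndep.insert {n : ℕ} {S : Finset ℕ} (hS : IsIndep n S) {v : ℕ} (hv : memG n v)
    (hvS : ∀ w ∈ S, ¬Adj v w) : IsIndep n (insert v S) := by
  refine ⟨fun w hw => ?_, fun w hw x hx hne => ?_⟩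
  · obtain rfl | hw := Finset.mem_insert.1 hw
    exacts [hv, hS.1 w hw]
  · rw [Finset.mem_insert] at hw hx
    obtain rfl | hw := hw <;> obtain rfl | hx := hx
    · exact absurd rfl hne
    · exact hvS x hx
    · exact fun ha => hvS w hw ha.symm
    · exact hS.2 w hw x hx hne

theorem mem_indepSets {n k : ℕ} {S : Finset ℕ} :
    S ∈ indepSets n k ↔ S.card = k ∧ IsIndep n S := by
  unfold indepSets IsIndep
  refine (@Finset.mem_filter _ _ (_) _ _).trans ?_
  rw [Finset.mem_powerset]
  refine ⟨fun hS => hS.2, fun hS => ⟨fun v hv => ?_, hS⟩⟩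
  have := hS.2.1 v hv
  unfold memG at this
  rw [Finset.mem_range]
  split_ifs at this <;> omega

theorem prodGen_insert {M : ℤ} (hM : 0 ≤ M) {h hb : ℤ → A} {b bb : ℤ → ℂ}
    (hyp : FFDHyp M h hb b bb) {S : Finset ℕ} {v : ℕ} (hv : v ∉ S)
    (hS : IsIndep M.toNat (insert v S)) :
    prodGen h hb (insert v S) = gen h hb v * prodGen h hb S := by
  unfold prodGen
  rw [← List.prod_cons, ← List.map_cons]
  refine List.Perm.prod_eq' (List.Perm.map _ ?_) ?_
  · rw [List.perm_ext_iff_of_nodup (Finset.sort_nodup _ _)]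
    · simp
    · simpa using hv
  · rw [List.pairwise_map]
    refine List.pairwise_of_forall_mem_list fun x hx y hy => ?_
    rw [Finset.mem_sort] at hx hy
    exact commute_gen_gen_of_not_adj hM hyp (hS.1 x hx) (hS.1 y hy) (hS.not_adj hx hy)

open Classical in
/-- The neighbours of `v` in `S`. -/
noncomputable def nbrs (v : ℕ) (S : Finset ℕ) : Finset ℕ := S.filter (Adj v)

theorem mem_nbrs {v w : ℕ} {S : Finset ℕ} : w ∈ nbrs v S ↔ w ∈ S ∧ Adj v w := by
  simp [nbrs]

theorem prodGen_mul_gen {M : ℤ} (hM : 0 ≤ M) {h hb : ℤ → A} {b bb : ℤ → ℂ}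
    (hyp : FFDHyp M h hb b bb) {S : Finset ℕ} {v : ℕ} (hv : memG M.toNat v)
    (hS : IsIndep M.toNat S) :
    prodGen h hb S * gen h hb v = (-1) ^ (nbrs v S).card * (gen h hb v * prodGen h hb S) := by
  induction S using Finset.induction_on with
  | empty => simp [prodGen, nbrs]
  | insert w S hw ih =>
    specialize ih (hS.mono (Finset.subset_insert w S))
    have hwm := hS.1 w (Finset.mem_insert_self w S)
    rw [prodGen_insert hM hyp hw hS, mul_assoc, ih]
    have hcen : ∀ n x, Commute ((-1 : A) ^ n) x := fun n x =>
      (Commute.neg_one_left x).pow_left n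
    rw [← mul_assoc, ← (hcen _ (gen h hb w)).eq, mul_assoc, ← mul_assoc (gen h hb w)]
    by_cases ha : Adj v w
    · have : nbrs v (insert w S) = insert w (nbrs v S) := by
        simp [nbrs, Finset.filter_insert, ha]
      rw [this, Finset.card_insert_of_notMem (by simp [nbrs, hw]),
        gen_mul_gen_of_adj hM hyp hwm hv ha.symm, pow_succ]
      simp [mul_assoc]
    · have : nbrs v (insert w S) = nbrs v S := by
        simp [nbrs, Finset.filter_insert, ha]
      rw [this, (commute_gen_gen_of_not_adj hM hyp hv hwm ha).symm.eq, mul_assoc]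

/-- The four kinds of claws of the frustration graph, with center `v` and leaves `a`, `b`, `d`;
the claws with equal parameter `q` contribute the four terms of one instance of `ACRel`. -/
def IsClaw (q v a b d : ℕ) : Prop :=
  (v = 2 * q + 7 ∧ a = 4 * q + 2 ∧ b = 4 * q + 10 ∧ d = 4 * q + 16) ∨
  (v = 2 * q + 7 ∧ a = 4 * q + 2 ∧ b = 4 * q + 12 ∧ d = 2 * q + 9) ∨
  (v = 4 * q + 6 ∧ a = 4 * q + 2 ∧ b = 4 * q + 8 ∧ d = 2 * q + 9) ∨
  (v = 4 * q + 6 ∧ a = 4 * q + 4 ∧ b = 2 * q + 5 ∧ d = 2 * q + 9)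

theorem adj_even_even {v w : ℕ} (hv : v % 2 = 0) (hw : w % 2 = 0) :
    Adj v w ↔ v ≠ w ∧ v ≤ w + 4 ∧ w ≤ v + 4 := by
  rw [adj_iff]; omega

theorem adj_odd_odd {v w : ℕ} (hv : v % 2 = 1) (hw : w % 2 = 1) :
    Adj v w ↔ v = w + 2 ∨ w = v + 2 := by
  rw [adj_iff]; omega

theorem adj_even_odd {v w : ℕ} (hv : v % 2 = 0) (hw : w % 2 = 1) :
    Adj v w ↔ v + 12 = 2 * w ∨ v + 8 = 2 * w ∨ v + 4 = 2 * w ∨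
      v + 2 = 2 * w ∨ v = 2 * w ∨ v = 2 * w + 2 := by
  rw [adj_iff]; omega

theorem adj_odd_even {v w : ℕ} (hv : v % 2 = 1) (hw : w % 2 = 0) :
    Adj v w ↔ w + 12 = 2 * v ∨ w + 8 = 2 * v ∨ w + 4 = 2 * v ∨
      w + 2 = 2 * v ∨ w = 2 * v ∨ w = 2 * v + 2 := by
  rw [adj_iff]; omega

/-- The order on vertex codes which puts the plain vertices before the barred ones. -/
def PlainFirst (v w : ℕ) : Prop := v % 2 < w % 2 ∨ v % 2 = w % 2 ∧ v < w

theorem exists_isClaw_of_odd {v a b d : ℕ} (hv : v % 2 = 1) (ha : Adj v a) (hb : Adj v b)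
    (hd : Adj v d) (ha0 : 0 < a) (hab : ¬Adj a b) (had : ¬Adj a d) (hbd : ¬Adj b d)
    (hab' : PlainFirst a b) (hbd' : PlainFirst b d) : ∃ q, IsClaw q v a b d := by
  refine ⟨(v - 7) / 2, ?_⟩
  unfold IsClaw
  unfold PlainFirst at hab' hbd'
  obtain h1 | h1 := Nat.mod_two_eq_zero_or_one a <;>
    obtain h2 | h2 := Nat.mod_two_eq_zero_or_one b <;>
    obtain h3 | h3 := Nat.mod_two_eq_zero_or_one d <;>
    simp only [hv, h1, h2, h3, adj_even_even, adj_odd_odd, adj_even_odd, adj_odd_even,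
      not_or] at ha hb hd hab had hbd hab' hbd'
  · replace hab' : a + 4 < b := by omega
    replace hbd' : b + 4 < d := by omega
    clear hab had hbd
    refine .inl ⟨by omega, ?_⟩
    rcases ha with ha | ha | ha | ha | ha | ha <;>
      rcases hb with hb | hb | hb | hb | hb | hb <;> omega
  · replace hab' : a + 4 < b := by omega
    clear hab
    rcases hd with hd | hd
    · have ha1 : 2 * v ≤ a := by clear hb hbd hab' hbd'; omega
      have hb1 : b ≤ 2 * v + 2 := by clear ha had hbd hab' hbd' ha1; omega
      exfalso
      omega
    · have ha1 : a + 12 = 2 * v ∨ a + 2 = 2 * v := by clear hb hbd hab' hbd'; omega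
      have hb1 : b + 12 = 2 * v ∨ b + 2 = 2 * v := by clear ha had hab' hbd' ha1; omega
      clear ha hb had hbd
      exact .inr (.inl (by omega))
  · exfalso; clear ha hb hd hab had hbd; omega
  · exfalso
    rcases hb with hb | hb <;> rcases hd with hd | hd <;> omega
  · exfalso; clear ha hb hd hab had hbd; omega
  · exfalso; clear ha hb hd hab had hbd; omega
  · exfalso; clear ha hb hd hab had hbd; omega
  · exfalso
    rcases hb with hb | hb <;> rcases hd with hd | hd <;> omega

theorem exists_isClaw_of_even {v a b d : ℕ} (hv : v % 2 = 0) (ha : Adj v a) (hb : Adj v b)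
    (hd : Adj v d) (ha0 : 0 < a) (hab : ¬Adj a b) (had : ¬Adj a d) (hbd : ¬Adj b d)
    (hab' : PlainFirst a b) (hbd' : PlainFirst b d) : ∃ q, IsClaw q v a b d := by
  refine ⟨(v - 6) / 4, ?_⟩
  unfold IsClaw
  unfold PlainFirst at hab' hbd'
  obtain h1 | h1 := Nat.mod_two_eq_zero_or_one a <;>
    obtain h2 | h2 := Nat.mod_two_eq_zero_or_one b <;>
    obtain h3 | h3 := Nat.mod_two_eq_zero_or_one d <;>
    simp only [hv, h1, h2, h3, adj_even_even, adj_odd_odd, adj_even_odd, adj_odd_even,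
      not_or] at ha hb hd hab had hbd hab' hbd'
  · replace hab' : a + 4 < b := by omega
    replace hbd' : b + 4 < d := by omega
    exfalso
    omega
  · replace hab' : a + 4 < b := by omega
    clear hab
    refine .inr (.inr (.inl ?_))
    rcases hd with hd | hd | hd | hd | hd | hd <;> omega
  · exfalso; clear ha hb hd hab had hbd; omega
  · replace hbd' : b + 2 < d := by omega
    clear hbd
    have ha1 : a = v + 2 ∨ a = v + 4 ∨ v = a + 2 ∨ v = a + 4 := by
      clear hb hd hab had hab' hbd'; omega
    clear ha
    rcases ha1 with ha | ha | ha | ha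
    · have hb1 : v + 12 = 2 * b ∨ v + 8 = 2 * b ∨ v = 2 * b + 2 := by
        clear hd had hbd'; omega
      have hd1 : v + 12 = 2 * d ∨ v + 8 = 2 * d ∨ v = 2 * d + 2 := by
        clear hb hb1 hab hbd'; omega
      clear hb hd hab had
      exfalso
      omega
    · have hb1 : v = 2 * b ∨ v = 2 * b + 2 := by clear hd had hbd'; omega
      have hd1 : v = 2 * d ∨ v = 2 * d + 2 := by clear hb hb1 hab hbd'; omega
      clear hb hd hab had
      exfalso
      omega
    · have hb1 : v + 12 = 2 * b ∨ v + 8 = 2 * b ∨ v + 4 = 2 * b := by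
        clear hd had hbd'; omega
      have hd1 : v + 12 = 2 * d ∨ v + 8 = 2 * d ∨ v + 4 = 2 * d := by
        clear hb hb1 hab hbd'; omega
      clear hb hd hab had
      exact .inr (.inr (.inr (by omega)))
    · have hb1 : v + 12 = 2 * b ∨ v + 2 = 2 * b := by clear hd had hbd'; omega
      have hd1 : v + 12 = 2 * d ∨ v + 2 = 2 * d := by clear hb hb1 hab hbd'; omega
      clear hb hd hab had
      exfalso
      omega
  · exfalso; clear ha hb hd hab had hbd; omega
  · exfalso; clear ha hb hd hab had hbd; omega
  · exfalso; clear ha hb hd hab had hbd; omega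
  · replace hab' : a + 2 < b := by omega
    replace hbd' : b + 2 < d := by omega
    clear hab had hbd
    exfalso
    omega

theorem exists_isClaw {n : ℕ} {S : Finset ℕ} (hS : IsIndep n S) {v : ℕ}
    (hc : 3 ≤ (nbrs v S).card) : ∃ q a b d, IsClaw q v a b d ∧
      a ∈ nbrs v S ∧ b ∈ nbrs v S ∧ d ∈ nbrs v S := by
  have sorted : ∀ a ∈ nbrs v S, ∀ b ∈ nbrs v S, ∀ d ∈ nbrs v S, PlainFirst a b →
      PlainFirst b d → ∃ q a b d, IsClaw q v a b d ∧
        a ∈ nbrs v S ∧ b ∈ nbrs v S ∧ d ∈ nbrs v S := by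
    intro a ha b hb d hd hab hbd
    have ha' := mem_nbrs.1 ha
    have hb' := mem_nbrs.1 hb
    have hd' := mem_nbrs.1 hd
    have ha0 : 0 < a := by
      have := hS.1 a ha'.1
      unfold memG at this
      split_ifs at this <;> omega
    have key : ∃ q, IsClaw q v a b d := by
      obtain hv | hv := Nat.mod_two_eq_zero_or_one v
      · exact exists_isClaw_of_even hv ha'.2 hb'.2 hd'.2 ha0 (hS.not_adj ha'.1 hb'.1)
          (hS.not_adj ha'.1 hd'.1) (hS.not_adj hb'.1 hd'.1) hab hbd
      · exact exists_isClaw_of_odd hv ha'.2 hb'.2 hd'.2 ha0 (hS.not_adj ha'.1 hb'.1)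
          (hS.not_adj ha'.1 hd'.1) (hS.not_adj hb'.1 hd'.1) hab hbd
    obtain ⟨q, hq⟩ := key
    exact ⟨q, a, b, d, hq, ha, hb, hd⟩
  have total : ∀ {x y : ℕ}, x ≠ y → PlainFirst x y ∨ PlainFirst y x := by
    intro x y hxy
    unfold PlainFirst
    omega
  obtain ⟨a, ha, b, hb, d, hd, hab, had, hbd⟩ := Finset.two_lt_card.1 hc
  obtain h1 | h1 := total hab <;> obtain h2 | h2 := total had <;> obtain h3 | h3 := total hbd
  · exact sorted a ha b hb d hd h1 h3
  · exact sorted a ha d hd b hb h2 h3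
  · exact sorted d hd a ha b hb h2 h1
  · exact sorted d hd a ha b hb h2 h1
  · exact sorted b hb a ha d hd h1 h2
  · exact sorted b hb a ha d hd h1 h2
  · exact sorted b hb d hd a ha h3 h2
  · exact sorted d hd b hb a ha h3 h1

theorem IsClaw.adj {q v a b d : ℕ} (hq : IsClaw q v a b d) : Adj v a ∧ Adj v b ∧ Adj v d := by
  simp only [adj_iff]
  rcases hq with ⟨rfl, rfl, rfl, rfl⟩ | ⟨rfl, rfl, rfl, rfl⟩ | ⟨rfl, rfl, rfl, rfl⟩ |
    ⟨rfl, rfl, rfl, rfl⟩ <;> refine ⟨?_, ?_, ?_⟩ <;> omega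

theorem IsClaw.not_adj {q v a b d : ℕ} (hq : IsClaw q v a b d) :
    ¬Adj a b ∧ ¬Adj a d ∧ ¬Adj b d := by
  simp only [adj_iff]
  rcases hq with ⟨rfl, rfl, rfl, rfl⟩ | ⟨rfl, rfl, rfl, rfl⟩ | ⟨rfl, rfl, rfl, rfl⟩ |
    ⟨rfl, rfl, rfl, rfl⟩ <;> refine ⟨?_, ?_, ?_⟩ <;> omega

theorem IsClaw.ne {q v a b d : ℕ} (hq : IsClaw q v a b d) : a ≠ b ∧ a ≠ d ∧ b ≠ d := by
  unfold IsClaw at hq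
  omega

/-- `w` is neither in nor adjacent to the claws with parameter `q`. -/
def Outer (q w : ℕ) : Prop :=
  (w % 2 = 0 → w + 2 < 4 * q ∨ 4 * q + 20 < w) ∧ (w % 2 = 1 → w < 2 * q + 1 ∨ 2 * q + 11 < w)

theorem Outer.not_adj {q w v a b d : ℕ} (hw : Outer q w) (hq : IsClaw q v a b d) :
    ¬Adj v w ∧ ¬Adj a w ∧ ¬Adj b w ∧ ¬Adj d w := by
  obtain h0 | h0 := Nat.mod_two_eq_zero_or_one w <;>
    rcases hq with hq | hq | hq | hq <;>
    obtain ⟨hv, ha, hb, hd⟩ := hq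
  · replace hw := hw.1 h0
    have hv2 : v % 2 = 1 := by omega
    have ha2 : a % 2 = 0 := by omega
    have hb2 : b % 2 = 0 := by omega
    have hd2 : d % 2 = 0 := by omega
    simp only [adj_even_even, adj_odd_even, h0, hv2, ha2, hb2, hd2]
    refine ⟨?_, ?_, ?_, ?_⟩ <;> omega
  · replace hw := hw.1 h0
    have hv2 : v % 2 = 1 := by omega
    have ha2 : a % 2 = 0 := by omega
    have hb2 : b % 2 = 0 := by omega
    have hd2 : d % 2 = 1 := by omega
    simp only [adj_even_even, adj_odd_even, h0, hv2, ha2, hb2, hd2]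
    refine ⟨?_, ?_, ?_, ?_⟩ <;> omega
  · replace hw := hw.1 h0
    have hv2 : v % 2 = 0 := by omega
    have ha2 : a % 2 = 0 := by omega
    have hb2 : b % 2 = 0 := by omega
    have hd2 : d % 2 = 1 := by omega
    simp only [adj_even_even, adj_odd_even, h0, hv2, ha2, hb2, hd2]
    refine ⟨?_, ?_, ?_, ?_⟩ <;> omega
  · replace hw := hw.1 h0
    have hv2 : v % 2 = 0 := by omega
    have ha2 : a % 2 = 0 := by omega
    have hb2 : b % 2 = 1 := by omega
    have hd2 : d % 2 = 1 := by omega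
    simp only [adj_even_even, adj_odd_even, h0, hv2, ha2, hb2, hd2]
    refine ⟨?_, ?_, ?_, ?_⟩ <;> omega
  · replace hw := hw.2 h0
    have hv2 : v % 2 = 1 := by omega
    have ha2 : a % 2 = 0 := by omega
    have hb2 : b % 2 = 0 := by omega
    have hd2 : d % 2 = 0 := by omega
    simp only [adj_even_odd, adj_odd_odd, h0, hv2, ha2, hb2, hd2]
    refine ⟨?_, ?_, ?_, ?_⟩ <;> omega
  · replace hw := hw.2 h0
    have hv2 : v % 2 = 1 := by omega
    have ha2 : a % 2 = 0 := by omega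
    have hb2 : b % 2 = 0 := by omega
    have hd2 : d % 2 = 1 := by omega
    simp only [adj_even_odd, adj_odd_odd, h0, hv2, ha2, hb2, hd2]
    refine ⟨?_, ?_, ?_, ?_⟩ <;> omega
  · replace hw := hw.2 h0
    have hv2 : v % 2 = 0 := by omega
    have ha2 : a % 2 = 0 := by omega
    have hb2 : b % 2 = 0 := by omega
    have hd2 : d % 2 = 1 := by omega
    simp only [adj_even_odd, adj_odd_odd, h0, hv2, ha2, hb2, hd2]
    refine ⟨?_, ?_, ?_, ?_⟩ <;> omega
  · replace hw := hw.2 h0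
    have hv2 : v % 2 = 0 := by omega
    have ha2 : a % 2 = 0 := by omega
    have hb2 : b % 2 = 1 := by omega
    have hd2 : d % 2 = 1 := by omega
    simp only [adj_even_odd, adj_odd_odd, h0, hv2, ha2, hb2, hd2]
    refine ⟨?_, ?_, ?_, ?_⟩ <;> omega

theorem Outer.ne {q w v a b d : ℕ} (hw : Outer q w) (hq : IsClaw q v a b d) :
    w ≠ a ∧ w ≠ b ∧ w ≠ d := by
  unfold Outer at hw
  unfold IsClaw at hq
  omega

theorem outer_of_not_adj {q w v a b d : ℕ} (hq : IsClaw q v a b d) (hv : ¬Adj v w)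
    (ha : ¬Adj a w) (hb : ¬Adj b w) (hd : ¬Adj d w) (_ : w ≠ a) (_ : w ≠ b) (_ : w ≠ d) :
    Outer q w := by
  obtain h0 | h0 := Nat.mod_two_eq_zero_or_one w <;>
    [refine ⟨fun _ => ?_, fun _ => by omega⟩; refine ⟨fun _ => by omega, fun _ => ?_⟩] <;>
    rcases hq with hq | hq | hq | hq <;>
    obtain ⟨h1, h2, h3, h4⟩ := hq
  · have hv2 : v % 2 = 1 := by omega
    have ha2 : a % 2 = 0 := by omega
    have hb2 : b % 2 = 0 := by omega
    have hd2 : d % 2 = 0 := by omega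
    simp only [adj_even_even, adj_odd_even, h0, hv2, ha2, hb2, hd2] at hv ha hb hd
    omega
  · have hv2 : v % 2 = 1 := by omega
    have ha2 : a % 2 = 0 := by omega
    have hb2 : b % 2 = 0 := by omega
    have hd2 : d % 2 = 1 := by omega
    simp only [adj_even_even, adj_odd_even, h0, hv2, ha2, hb2, hd2] at hv ha hb hd
    omega
  · have hv2 : v % 2 = 0 := by omega
    have ha2 : a % 2 = 0 := by omega
    have hb2 : b % 2 = 0 := by omega
    have hd2 : d % 2 = 1 := by omega
    simp only [adj_even_even, adj_odd_even, h0, hv2, ha2, hb2, hd2] at hv ha hb hd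
    omega
  · have hv2 : v % 2 = 0 := by omega
    have ha2 : a % 2 = 0 := by omega
    have hb2 : b % 2 = 1 := by omega
    have hd2 : d % 2 = 1 := by omega
    simp only [adj_even_even, adj_odd_even, h0, hv2, ha2, hb2, hd2] at hv ha hb hd
    omega
  · have hv2 : v % 2 = 1 := by omega
    have ha2 : a % 2 = 0 := by omega
    have hb2 : b % 2 = 0 := by omega
    have hd2 : d % 2 = 0 := by omega
    simp only [adj_even_odd, adj_odd_odd, h0, hv2, ha2, hb2, hd2] at hv ha hb hd
    omega
  · have hv2 : v % 2 = 1 := by omega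
    have ha2 : a % 2 = 0 := by omega
    have hb2 : b % 2 = 0 := by omega
    have hd2 : d % 2 = 1 := by omega
    simp only [adj_even_odd, adj_odd_odd, h0, hv2, ha2, hb2, hd2] at hv ha hb hd
    omega
  · have hv2 : v % 2 = 0 := by omega
    have ha2 : a % 2 = 0 := by omega
    have hb2 : b % 2 = 0 := by omega
    have hd2 : d % 2 = 1 := by omega
    simp only [adj_even_odd, adj_odd_odd, h0, hv2, ha2, hb2, hd2] at hv ha hb hd
    omega
  · have hv2 : v % 2 = 0 := by omega
    have ha2 : a % 2 = 0 := by omega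
    have hb2 : b % 2 = 1 := by omega
    have hd2 : d % 2 = 1 := by omega
    simp only [adj_even_odd, adj_odd_odd, h0, hv2, ha2, hb2, hd2] at hv ha hb hd
    omega

theorem IsClaw.mem_of_adj {q v a b d w : ℕ} (hq : IsClaw q v a b d) (hv : Adj v w)
    (ha : ¬Adj a w) (hb : ¬Adj b w) (hd : ¬Adj d w) : w = a ∨ w = b ∨ w = d := by
  obtain h0 | h0 := Nat.mod_two_eq_zero_or_one w <;>
    rcases hq with hq | hq | hq | hq <;>
    obtain ⟨h1, h2, h3, h4⟩ := hq
  · have hv2 : v % 2 = 1 := by omega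
    have ha2 : a % 2 = 0 := by omega
    have hb2 : b % 2 = 0 := by omega
    have hd2 : d % 2 = 0 := by omega
    simp only [adj_even_even, adj_odd_even, h0, hv2, ha2, hb2, hd2] at hv ha hb hd
    omega
  · have hv2 : v % 2 = 1 := by omega
    have ha2 : a % 2 = 0 := by omega
    have hb2 : b % 2 = 0 := by omega
    have hd2 : d % 2 = 1 := by omega
    simp only [adj_even_even, adj_odd_even, h0, hv2, ha2, hb2, hd2] at hv ha hb hd
    omega
  · have hv2 : v % 2 = 0 := by omega
    have ha2 : a % 2 = 0 := by omega
    have hb2 : b % 2 = 0 := by omega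
    have hd2 : d % 2 = 1 := by omega
    simp only [adj_even_even, adj_odd_even, h0, hv2, ha2, hb2, hd2] at hv ha hb hd
    omega
  · have hv2 : v % 2 = 0 := by omega
    have ha2 : a % 2 = 0 := by omega
    have hb2 : b % 2 = 1 := by omega
    have hd2 : d % 2 = 1 := by omega
    simp only [adj_even_even, adj_odd_even, h0, hv2, ha2, hb2, hd2] at hv ha hb hd
    omega
  · have hv2 : v % 2 = 1 := by omega
    have ha2 : a % 2 = 0 := by omega
    have hb2 : b % 2 = 0 := by omega
    have hd2 : d % 2 = 0 := by omega
    simp only [adj_even_odd, adj_odd_odd, h0, hv2, ha2, hb2, hd2] at hv ha hb hd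
    omega
  · have hv2 : v % 2 = 1 := by omega
    have ha2 : a % 2 = 0 := by omega
    have hb2 : b % 2 = 0 := by omega
    have hd2 : d % 2 = 1 := by omega
    simp only [adj_even_odd, adj_odd_odd, h0, hv2, ha2, hb2, hd2] at hv ha hb hd
    omega
  · have hv2 : v % 2 = 0 := by omega
    have ha2 : a % 2 = 0 := by omega
    have hb2 : b % 2 = 0 := by omega
    have hd2 : d % 2 = 1 := by omega
    simp only [adj_even_odd, adj_odd_odd, h0, hv2, ha2, hb2, hd2] at hv ha hb hd
    omega
  · have hv2 : v % 2 = 0 := by omega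
    have ha2 : a % 2 = 0 := by omega
    have hb2 : b % 2 = 1 := by omega
    have hd2 : d % 2 = 1 := by omega
    simp only [adj_even_odd, adj_odd_odd, h0, hv2, ha2, hb2, hd2] at hv ha hb hd
    omega

theorem IsClaw.memG {n q v a b d : ℕ} (hq : IsClaw q v a b d) (hn : 2 * q + 8 ≤ n) :
    memG n v ∧ memG n a ∧ memG n b ∧ memG n d := by
  unfold FFD.memG
  refine ⟨?_, ?_, ?_, ?_⟩ <;> split_ifs <;>
    rcases hq with hq | hq | hq | hq <;> omega

theorem IsClaw.le {n q v a b d : ℕ} (hq : IsClaw q v a b d)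
    (hb : FFD.memG n b) (hd : FFD.memG n d) : 2 * q + 8 ≤ n := by
  unfold FFD.memG at hb hd
  split_ifs at hb hd <;> rcases hq with hq | hq | hq | hq <;> omega

/-- The parameter `q` of the claws centered at `v`. -/
def clawParam (v : ℕ) : ℕ := if v % 2 = 0 then (v - 6) / 4 else (v - 7) / 2

theorem IsClaw.clawParam_eq {q v a b d : ℕ} (hq : IsClaw q v a b d) : clawParam v = q := by
  unfold clawParam
  split_ifs <;> rcases hq with hq | hq | hq | hq <;> omega

theorem IsIndep.nbrs_eq_of_isClaw {n : ℕ} {S : Finset ℕ} (hS : IsIndep n S) {q v a b d : ℕ}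
    (hq : IsClaw q v a b d) (ha : a ∈ S) (hb : b ∈ S) (hd : d ∈ S) :
    nbrs v S = {a, b, d} := by
  ext w
  rw [mem_nbrs, Finset.mem_insert, Finset.mem_insert, Finset.mem_singleton]
  constructor
  · rintro ⟨hw, hvw⟩
    exact hq.mem_of_adj hvw (hS.not_adj ha hw) (hS.not_adj hb hw) (hS.not_adj hd hw)
  · rintro (rfl | rfl | rfl)
    exacts [⟨ha, hq.adj.1⟩, ⟨hb, hq.adj.2.1⟩, ⟨hd, hq.adj.2.2⟩]

theorem exists_claw_decomposition {n : ℕ} {S : Finset ℕ} (hS : IsIndep n S) {v : ℕ}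
    (hc : 3 ≤ (nbrs v S).card) : ∃ q a b d, IsClaw q v a b d ∧ 2 * q + 8 ≤ n ∧
      (∀ w ∈ S \ nbrs v S, Outer q w) ∧
      S = insert a (insert b (insert d (S \ nbrs v S))) := by
  obtain ⟨q, a, b, d, hq, ha, hb, hd⟩ := exists_isClaw hS hc
  rw [mem_nbrs] at ha hb hd
  have hN := hS.nbrs_eq_of_isClaw hq ha.1 hb.1 hd.1
  refine ⟨q, a, b, d, hq, hq.le (hS.1 b hb.1) (hS.1 d hd.1), fun w hw => ?_, ?_⟩
  · rw [Finset.mem_sdiff, mem_nbrs] at hw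
    refine outer_of_not_adj hq (fun h => hw.2 ⟨hw.1, h⟩) (hS.not_adj ha.1 hw.1)
      (hS.not_adj hb.1 hw.1) (hS.not_adj hd.1 hw.1) ?_ ?_ ?_
    · rintro rfl; exact hw.2 ha
    · rintro rfl; exact hw.2 hb
    · rintro rfl; exact hw.2 hd
  · rw [hN]
    ext w
    simp only [Finset.mem_insert, Finset.mem_sdiff, Finset.mem_singleton]
    constructor
    · tauto
    · rintro (rfl | rfl | rfl | hw)
      exacts [ha.1, hb.1, hd.1, hw.1]

section ClawExtension

variable {n q v a b d : ℕ} {R : Finset ℕ}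

theorem IsClaw.notMem (hq : IsClaw q v a b d) (hR : ∀ w ∈ R, Outer q w) :
    a ∉ R ∧ b ∉ R ∧ d ∉ R :=
  ⟨fun h => ((hR a h).ne hq).1 rfl, fun h => ((hR b h).ne hq).2.1 rfl,
    fun h => ((hR d h).ne hq).2.2 rfl⟩

theorem IsClaw.isIndep_leaf (hq : IsClaw q v a b d) (hn : 2 * q + 8 ≤ n)
    (hRi : IsIndep n R) (hR : ∀ w ∈ R, Outer q w) : IsIndep n (insert d R) :=
  hRi.insert (hq.memG hn).2.2.2 fun w hw => ((hR w hw).not_adj hq).2.2.2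

theorem IsClaw.isIndep_two_leaves (hq : IsClaw q v a b d) (hn : 2 * q + 8 ≤ n)
    (hRi : IsIndep n R) (hR : ∀ w ∈ R, Outer q w) : IsIndep n (insert b (insert d R)) := by
  refine (hq.isIndep_leaf hn hRi hR).insert (hq.memG hn).2.2.1 fun w hw => ?_
  obtain rfl | hw := Finset.mem_insert.1 hw
  exacts [hq.not_adj.2.2, ((hR w hw).not_adj hq).2.2.1]

theorem IsClaw.isIndep_leaves (hq : IsClaw q v a b d) (hn : 2 * q + 8 ≤ n)
    (hRi : IsIndep n R) (hR : ∀ w ∈ R, Outer q w) :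
    IsIndep n (insert a (insert b (insert d R))) := by
  refine (hq.isIndep_two_leaves hn hRi hR).insert (hq.memG hn).2.1 fun w hw => ?_
  rw [Finset.mem_insert, Finset.mem_insert] at hw
  obtain rfl | rfl | hw := hw
  exacts [hq.not_adj.1, hq.not_adj.2.1, ((hR w hw).not_adj hq).2.1]

theorem IsClaw.card_leaves (hq : IsClaw q v a b d) (hR : ∀ w ∈ R, Outer q w) :
    (insert a (insert b (insert d R))).card = R.card + 3 := by
  have hne := hq.ne
  have hm := hq.notMem hR
  rw [Finset.card_insert_of_notMem, Finset.card_insert_of_notMem, Finset.card_insert_of_notMem]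
  all_goals simp [hm, hne]

theorem IsClaw.nbrs_leaves (hq : IsClaw q v a b d) (hn : 2 * q + 8 ≤ n)
    (hRi : IsIndep n R) (hR : ∀ w ∈ R, Outer q w) :
    nbrs v (insert a (insert b (insert d R))) = {a, b, d} :=
  (hq.isIndep_leaves hn hRi hR).nbrs_eq_of_isClaw hq (by simp) (by simp) (by simp)

theorem IsClaw.card_nbrs_leaves (hq : IsClaw q v a b d) (hn : 2 * q + 8 ≤ n)
    (hRi : IsIndep n R) (hR : ∀ w ∈ R, Outer q w) :
    (nbrs v (insert a (insert b (insert d R)))).card = 3 := by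
  rw [hq.nbrs_leaves hn hRi hR, Finset.card_eq_three]
  exact ⟨a, b, d, hq.ne.1, hq.ne.2.1, hq.ne.2.2, rfl⟩

theorem IsClaw.sdiff_nbrs_leaves (hq : IsClaw q v a b d) (hn : 2 * q + 8 ≤ n)
    (hRi : IsIndep n R) (hR : ∀ w ∈ R, Outer q w) :
    insert a (insert b (insert d R)) \ nbrs v (insert a (insert b (insert d R))) = R := by
  rw [hq.nbrs_leaves hn hRi hR]
  ext w
  simp only [Finset.mem_insert, Finset.mem_sdiff, Finset.mem_singleton]
  constructor
  · tauto
  · intro hw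
    have := (hR w hw).ne hq
    tauto

end ClawExtension

/-- The commutator of the generator of `p.1` with the product of the generators of `p.2`. -/
noncomputable def comm (h hb : ℤ → A) (p : ℕ × Finset ℕ) : A :=
  gen h hb p.1 * prodGen h hb p.2 - prodGen h hb p.2 * gen h hb p.1

theorem IsClaw.comm_eq {M : ℤ} (hM : 0 ≤ M) {h hb : ℤ → A} {b bb : ℤ → ℂ}
    (hyp : FFDHyp M h hb b bb) {q v x y z : ℕ} {R : Finset ℕ} (hq : IsClaw q v x y z)
    (hn : 2 * q + 8 ≤ M.toNat) (hRi : IsIndep M.toNat R) (hR : ∀ w ∈ R, Outer q w) :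
    comm h hb (v, insert x (insert y (insert z R))) =
      2 * (gen h hb v * (gen h hb x * (gen h hb y * gen h hb z)) * prodGen h hb R) := by
  have hm := hq.notMem hR
  have hne := hq.ne
  unfold comm
  simp only
  rw [prodGen_mul_gen hM hyp (hq.memG hn).1 (hq.isIndep_leaves hn hRi hR),
    hq.card_nbrs_leaves hn hRi hR,
    prodGen_insert hM hyp (by simp [hm, hne]) (hq.isIndep_leaves hn hRi hR),
    prodGen_insert hM hyp (by simp [hm, hne]) (hq.isIndep_two_leaves hn hRi hR),
    prodGen_insert hM hyp hm.2.2 (hq.isIndep_leaf hn hRi hR)]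
  simp only [mul_assoc]
  noncomm_ring

theorem sum_claws_eq_zero {M : ℤ} (hM : 0 ≤ M) {h hb : ℤ → A} {b bb : ℤ → ℂ}
    (hyp : FFDHyp M h hb b bb) (hac : ACRel M h hb) {q : ℕ} (hq : 2 * q + 8 ≤ M.toNat) :
    gen h hb (2 * q + 7) * (gen h hb (4 * q + 2) * (gen h hb (4 * q + 10) *
        gen h hb (4 * q + 16))) +
      (gen h hb (2 * q + 7) * (gen h hb (4 * q + 2) * (gen h hb (4 * q + 12) *
        gen h hb (2 * q + 9))) +
      (gen h hb (4 * q + 6) * (gen h hb (4 * q + 2) * (gen h hb (4 * q + 8) *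
        gen h hb (2 * q + 9))) +
      gen h hb (4 * q + 6) * (gen h hb (4 * q + 4) * (gen h hb (2 * q + 5) *
        gen h hb (2 * q + 9))))) = 0 := by
  have plain : ∀ (c : ℕ) (i : ℤ), c % 2 = 0 → i = ((c / 2 : ℕ) : ℤ) → h i = gen h hb c :=
    fun c i hc hi => by rw [gen, if_pos hc, hi]
  have barred : ∀ (c : ℕ) (i : ℤ), c % 2 = 1 → i = ((c / 2 : ℕ) : ℤ) → hb i = gen h hb c :=
    fun c i hc hi => by rw [gen, if_neg (by omega), hi]
  have rel := hac (q + 2) (by omega) (by omega)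
  unfold AOp COp at rel
  rw [plain (4 * q + 8) (2 * (q + 2)) (by omega) (by omega),
    plain (4 * q + 2) (2 * (q + 2) - 3) (by omega) (by omega),
    plain (4 * q + 4) (2 * (q + 2) - 2) (by omega) (by omega),
    barred (2 * q + 5) (q + 2) (by omega) (by omega),
    plain (4 * q + 6) (2 * (q + 2 + 1) - 3) (by omega) (by omega),
    barred (2 * q + 9) (q + 2 + 1 + 1) (by omega) (by omega),
    barred (2 * q + 7) (q + 2 + 1) (by omega) (by omega),
    plain (4 * q + 16) (2 * (q + 2 + 2)) (by omega) (by omega),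
    plain (4 * q + 10) (2 * (q + 2 + 2) - 3) (by omega) (by omega),
    plain (4 * q + 12) (2 * (q + 2 + 2) - 2) (by omega) (by omega),
    barred (2 * q + 9) (q + 2 + 2) (by omega) (by omega)] at rel
  have mem : ∀ c, 0 < c → c % 2 = 0 ∧ c ≤ 4 * q + 16 ∨ c % 2 = 1 ∧ c ≤ 2 * q + 9 →
      memG M.toNat c := by
    intro c hc hc'
    unfold memG
    split_ifs <;> omega
  have anti : ∀ c e, memG M.toNat c → memG M.toNat e → Adj c e →
      gen h hb c * gen h hb e = -(gen h hb e * gen h hb c) := fun c e hc he =>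
    gen_mul_gen_of_adj hM hyp hc he
  have cmm : ∀ c e, memG M.toNat c → memG M.toNat e → ¬Adj c e →
      gen h hb c * gen h hb e = gen h hb e * gen h hb c := fun c e hc he hce =>
    (commute_gen_gen_of_not_adj hM hyp hc he hce).eq
  have e1 := anti (2 * q + 7) (4 * q + 2) (mem _ (by omega) (by omega))
    (mem _ (by omega) (by omega)) (by rw [adj_odd_even] <;> omega)
  have e2 := cmm (4 * q + 10) (4 * q + 16) (mem _ (by omega) (by omega))
    (mem _ (by omega) (by omega)) (by rw [adj_even_even] <;> omega)
  have e3 := anti (4 * q + 6) (4 * q + 2) (mem _ (by omega) (by omega))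
    (mem _ (by omega) (by omega)) (by rw [adj_even_even] <;> omega)
  have e4 := anti (4 * q + 6) (4 * q + 8) (mem _ (by omega) (by omega))
    (mem _ (by omega) (by omega)) (by rw [adj_even_even] <;> omega)
  have e5 := cmm (4 * q + 2) (4 * q + 8) (mem _ (by omega) (by omega))
    (mem _ (by omega) (by omega)) (by rw [adj_even_even] <;> omega)
  have e6 := anti (4 * q + 6) (4 * q + 4) (mem _ (by omega) (by omega))
    (mem _ (by omega) (by omega)) (by rw [adj_even_even] <;> omega)
  have e7 := anti (4 * q + 6) (2 * q + 5) (mem _ (by omega) (by omega))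
    (mem _ (by omega) (by omega)) (by rw [adj_even_odd] <;> omega)
  generalize gen h hb (2 * q + 7) = s at *
  generalize gen h hb (4 * q + 2) = x at *
  generalize gen h hb (4 * q + 4) = u at *
  generalize gen h hb (4 * q + 6) = y at *
  generalize gen h hb (4 * q + 8) = z at *
  generalize gen h hb (4 * q + 10) = r at *
  generalize gen h hb (4 * q + 12) = o at *
  generalize gen h hb (4 * q + 16) = p at *
  generalize gen h hb (2 * q + 5) = w at *
  generalize gen h hb (2 * q + 9) = t at *
  have f1 : s * (x * (r * p)) = -(x * s * (p * r)) := by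
    rw [e2, ← mul_assoc, e1, neg_mul]
  have f2 : s * (x * (o * t)) = -(x * s * (o * t)) := by
    rw [← mul_assoc, e1, neg_mul]
  have f3 : y * (x * (z * t)) = z * x * (y * t) := by
    rw [← mul_assoc x, e5, mul_assoc z, ← mul_assoc y, e4, neg_mul, mul_assoc z, ← mul_assoc y,
      e3]
    simp [mul_assoc]
  have f4 : y * (u * (w * t)) = u * w * (y * t) := by
    rw [← mul_assoc y, e6, neg_mul, mul_assoc u, ← mul_assoc y, e7]
    simp [mul_assoc]
  rw [f1, f2, f3, f4, ← add_mul (z * x), rel]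
  noncomm_ring

open Classical in
/-- The pairs of a vertex and an independent set of cardinality `k`. -/
noncomputable def pairs (n k : ℕ) : Finset (ℕ × Finset ℕ) :=
  {v ∈ Finset.range (2 * n + 2) | memG n v} ×ˢ indepSets n k

theorem mem_range_of_memG {n v : ℕ} (hv : memG n v) : v ∈ Finset.range (2 * n + 2) := by
  unfold memG at hv
  rw [Finset.mem_range]
  split_ifs at hv <;> omega

theorem mem_pairs {n k v : ℕ} {S : Finset ℕ} :
    (v, S) ∈ pairs n k ↔ memG n v ∧ S.card = k ∧ IsIndep n S := by
  simp only [pairs, Finset.mem_product, Finset.mem_filter, mem_indepSets]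
  exact ⟨fun hp => ⟨hp.1.2, hp.2⟩, fun hp => ⟨⟨mem_range_of_memG hp.1, hp.1⟩, hp.2⟩⟩

theorem sum_gen_eq_sum_indepSets_one (n : ℕ) (h hb : ℤ → A) [DecidablePred (memG n)] :
    ∑ v ∈ Finset.range (2 * n + 2) with memG n v, gen h hb v =
      ∑ S ∈ indepSets n 1, prodGen h hb S := by
  refine Finset.sum_bij (fun v _ => {v}) ?_ ?_ ?_ ?_
  · intro v hv
    rw [mem_indepSets]
    refine ⟨Finset.card_singleton v, ?_, ?_⟩
    · simpa using (Finset.mem_filter.1 hv).2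
    · simp
  · intro v _ w _ hvw
    exact Finset.singleton_injective hvw
  · intro S hS
    rw [mem_indepSets, Finset.card_eq_one] at hS
    obtain ⟨⟨v, rfl⟩, hS⟩ := hS
    have hv := hS.1 v (Finset.mem_singleton_self v)
    exact ⟨v, Finset.mem_filter.2 ⟨mem_range_of_memG hv, hv⟩, rfl⟩
  · intro v _
    simp [prodGen]

theorem sum_comm_of_card_nbrs_eq_one {M : ℤ} (hM : 0 ≤ M) {h hb : ℤ → A} {b bb : ℤ → ℂ}
    (hyp : FFDHyp M h hb b bb) (k : ℕ) :
    ∑ p ∈ pairs M.toNat k with (nbrs p.1 p.2).card = 1, comm h hb p = 0 := by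
  have key : ∀ v S, (v, S) ∈ {p ∈ pairs M.toNat k | (nbrs p.1 p.2).card = 1} →
      ∃ w R, S = insert w R ∧ nbrs v (insert w R) = {w} ∧ nbrs w (insert v R) = {v} ∧
        v ∉ R ∧ w ∉ R ∧ v ≠ w ∧ memG M.toNat v ∧ memG M.toNat w ∧ Adj v w ∧ R.card + 1 = k ∧
        IsIndep M.toNat (insert w R) ∧ IsIndep M.toNat (insert v R) := by
    intro v S hp
    rw [Finset.mem_filter, mem_pairs, Finset.card_eq_one] at hp
    obtain ⟨⟨hv, hk, hS⟩, w, hw⟩ := hp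
    have hwS : w ∈ S ∧ Adj v w := by rw [← mem_nbrs]; simp [hw]
    have hvS : v ∉ S := fun h => hS.not_adj h hwS.1 hwS.2
    have hins : insert w (S.erase w) = S := Finset.insert_erase hwS.1
    have hother : ∀ x ∈ S.erase w, ¬Adj v x := fun x hx ha => by
      have : x ∈ nbrs v S := mem_nbrs.2 ⟨Finset.mem_of_mem_erase hx, ha⟩
      rw [hw, Finset.mem_singleton] at this
      exact Finset.ne_of_mem_erase hx this
    refine ⟨w, S.erase w, hins.symm, by rw [hins]; exact hw, ?_,
      fun h => hvS (Finset.mem_of_mem_erase h), Finset.notMem_erase w S,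
      fun h => hvS (h ▸ hwS.1), hv, hS.1 w hwS.1, hwS.2, ?_, by rwa [hins],
      (hS.mono (Finset.erase_subset w S)).insert hv hother⟩
    · ext x
      rw [mem_nbrs, Finset.mem_insert, Finset.mem_singleton]
      constructor
      · rintro ⟨rfl | hx, ha⟩
        · rfl
        · exact absurd ha (hS.not_adj hwS.1 (Finset.mem_of_mem_erase hx))
      · rintro rfl
        exact ⟨.inl rfl, hwS.2.symm⟩
    · rw [Finset.card_erase_add_one hwS.1, hk]
  have hval : ∀ {v w R}, nbrs v (insert w R) = {w} →
      w ∉ R → memG M.toNat v → IsIndep M.toNat (insert w R) →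
      comm h hb (v, insert w R) = 2 * (gen h hb v * gen h hb w * prodGen h hb R) := by
    intro v w R hn hwR hv hi
    unfold comm
    simp only
    rw [prodGen_mul_gen hM hyp hv hi, hn, prodGen_insert hM hyp hwR hi, Finset.card_singleton]
    noncomm_ring
  refine Finset.sum_involution
    (fun p _ => ((nbrs p.1 p.2).sum id, insert p.1 (p.2 \ nbrs p.1 p.2))) ?_ ?_ ?_ ?_
  · rintro ⟨v, S⟩ hp
    obtain ⟨w, R, rfl, hn, hn', hvR, hwR, hne, hv, hw, ha, -, hi, hi'⟩ := key v S hp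
    have hR : insert w R \ {w} = R := by
      rw [Finset.sdiff_singleton_eq_erase, Finset.erase_insert hwR]
    simp only [hn, Finset.sum_singleton, id, hR]
    rw [hval hn hwR hv hi, hval hn' hvR hw hi', gen_mul_gen_of_adj hM hyp hv hw ha]
    noncomm_ring
  · rintro ⟨v, S⟩ hp - heq
    obtain ⟨w, R, rfl, hn, -, -, -, hne, -⟩ := key v S hp
    simp only [hn, Finset.sum_singleton, id, Prod.mk.injEq] at heq
    exact hne heq.1.symm
  · rintro ⟨v, S⟩ hp
    obtain ⟨w, R, rfl, hn, hn', hvR, hwR, hne, hv, hw, ha, hk, hi, hi'⟩ := key v S hp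
    have hR : insert w R \ {w} = R := by
      rw [Finset.sdiff_singleton_eq_erase, Finset.erase_insert hwR]
    simp only [hn, Finset.sum_singleton, id, hR]
    rw [Finset.mem_filter, mem_pairs]
    exact ⟨⟨hw, by rw [Finset.card_insert_of_notMem hvR, hk], hi'⟩, by simp [hn']⟩
  · rintro ⟨v, S⟩ hp
    obtain ⟨w, R, rfl, hn, hn', hvR, hwR, hne, hv, hw, ha, hk, hi, hi'⟩ := key v S hp
    have hR : insert w R \ {w} = R := by
      rw [Finset.sdiff_singleton_eq_erase, Finset.erase_insert hwR]
    have hR' : insert v R \ {v} = R := by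
      rw [Finset.sdiff_singleton_eq_erase, Finset.erase_insert hvR]
    simp only [hn, Finset.sum_singleton, id, hR, hn', hR']

theorem sum_comm_of_three_le_card_nbrs {M : ℤ} (hM : 0 ≤ M) {h hb : ℤ → A} {b bb : ℤ → ℂ}
    (hyp : FFDHyp M h hb b bb) (hac : ACRel M h hb) (k : ℕ) :
    ∑ p ∈ pairs M.toNat k with 3 ≤ (nbrs p.1 p.2).card, comm h hb p = 0 := by
  set T := {p ∈ pairs M.toNat k | 3 ≤ (nbrs p.1 p.2).card} with hT
  let key : ℕ × Finset ℕ → ℕ × Finset ℕ := fun p => (clawParam p.1, p.2 \ nbrs p.1 p.2)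
  rw [← Finset.sum_fiberwise_of_maps_to (g := key) fun p => Finset.mem_image_of_mem key]
  refine Finset.sum_eq_zero fun κ hκ => ?_
  obtain ⟨⟨v, S⟩, hp, rfl⟩ := Finset.mem_image.1 hκ
  rw [hT, Finset.mem_filter, mem_pairs] at hp
  obtain ⟨⟨-, hk, hS⟩, hc⟩ := hp
  obtain ⟨q, x, y, z, hq, hn, hR, hSR⟩ := exists_claw_decomposition hS hc
  have hRi : IsIndep M.toNat (S \ nbrs v S) := hS.mono Finset.sdiff_subset
  have hcard := hq.card_leaves hR
  rw [← hSR, hk] at hcard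
  have hkey : key (v, S) = (q, S \ nbrs v S) := by simp only [key, hq.clawParam_eq]
  rw [hkey]
  generalize S \ nbrs v S = R at hR hRi hcard
  have c1 : IsClaw q (2 * q + 7) (4 * q + 2) (4 * q + 10) (4 * q + 16) :=
    .inl ⟨rfl, rfl, rfl, rfl⟩
  have c2 : IsClaw q (2 * q + 7) (4 * q + 2) (4 * q + 12) (2 * q + 9) :=
    .inr (.inl ⟨rfl, rfl, rfl, rfl⟩)
  have c3 : IsClaw q (4 * q + 6) (4 * q + 2) (4 * q + 8) (2 * q + 9) :=
    .inr (.inr (.inl ⟨rfl, rfl, rfl, rfl⟩))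
  have c4 : IsClaw q (4 * q + 6) (4 * q + 4) (2 * q + 5) (2 * q + 9) :=
    .inr (.inr (.inr ⟨rfl, rfl, rfl, rfl⟩))
  have hmem : ∀ {v x y z}, IsClaw q v x y z →
      (v, insert x (insert y (insert z R))) ∈ {p ∈ T | key p = (q, R)} := by
    intro v x y z hq
    rw [Finset.mem_filter, hT, Finset.mem_filter, mem_pairs]
    refine ⟨⟨⟨(hq.memG hn).1, by rw [hq.card_leaves hR, hcard], hq.isIndep_leaves hn hRi hR⟩,
      (hq.card_nbrs_leaves hn hRi hR).ge⟩, ?_⟩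
    simp only [key, hq.clawParam_eq, hq.sdiff_nbrs_leaves hn hRi hR]
  have hfib : {p ∈ T | key p = (q, R)} =
      {(2 * q + 7, insert (4 * q + 2) (insert (4 * q + 10) (insert (4 * q + 16) R))),
        (2 * q + 7, insert (4 * q + 2) (insert (4 * q + 12) (insert (2 * q + 9) R))),
        (4 * q + 6, insert (4 * q + 2) (insert (4 * q + 8) (insert (2 * q + 9) R))),
        (4 * q + 6, insert (4 * q + 4) (insert (2 * q + 5) (insert (2 * q + 9) R)))} := by
    ext ⟨v', S'⟩
    simp only [Finset.mem_insert, Finset.mem_singleton]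
    constructor
    · intro hp
      rw [Finset.mem_filter, hT, Finset.mem_filter, mem_pairs] at hp
      obtain ⟨⟨⟨-, -, hS'⟩, hc'⟩, hk'⟩ := hp
      obtain ⟨q', x', y', z', hq', -, -, hSR'⟩ := exists_claw_decomposition hS' hc'
      simp only [key, hq'.clawParam_eq, Prod.mk.injEq] at hk'
      obtain ⟨rfl, hk'⟩ := hk'
      rw [hk'] at hSR'
      rcases hq' with ⟨rfl, rfl, rfl, rfl⟩ | ⟨rfl, rfl, rfl, rfl⟩ | ⟨rfl, rfl, rfl, rfl⟩ |
        ⟨rfl, rfl, rfl, rfl⟩ <;> rw [hSR'] <;> simp only [true_or, or_true]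
    · rintro (hp | hp | hp | hp) <;> rw [hp]
      exacts [hmem c1, hmem c2, hmem c3, hmem c4]
  have hne : ∀ {v v' x y z x' y' z'}, IsClaw q v x y z → IsClaw q v' x' y' z' →
      (v, insert x (insert y (insert z R))) = (v', insert x' (insert y' (insert z' R))) →
      v = v' ∧ (y = x' ∨ y = y' ∨ y = z') := by
    intro v v' x y z x' y' z' hq hq' heq
    obtain ⟨rfl, hset⟩ := Prod.mk.inj heq
    have h1 := hq.nbrs_leaves hn hRi hR
    rw [hset, hq'.nbrs_leaves hn hRi hR] at h1
    have hy : y ∈ ({x', y', z'} : Finset ℕ) := by rw [h1]; simp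
    exact ⟨rfl, by simpa using hy⟩
  rw [hfib, Finset.sum_insert, Finset.sum_insert, Finset.sum_insert, Finset.sum_singleton,
    c1.comm_eq hM hyp hn hRi hR, c2.comm_eq hM hyp hn hRi hR, c3.comm_eq hM hyp hn hRi hR,
    c4.comm_eq hM hyp hn hRi hR]
  · have h0 := congrArg (fun t => 2 * (t * prodGen h hb R)) (sum_claws_eq_zero hM hyp hac hn)
    simpa only [add_mul, mul_add, zero_mul, mul_zero, add_assoc] using h0
  · rw [Finset.mem_singleton]
    intro heq
    have := hne c3 c4 heq
    omega
  · rw [Finset.mem_insert, Finset.mem_singleton]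
    rintro (heq | heq)
    · have := hne c2 c3 heq
      omega
    · have := hne c2 c4 heq
      omega
  · rw [Finset.mem_insert, Finset.mem_insert, Finset.mem_singleton]
    rintro (heq | heq | heq)
    · have := hne c1 c2 heq
      omega
    · have := hne c1 c3 heq
      omega
    · have := hne c1 c4 heq
      omega

theorem sum_comm_eq_zero {M : ℤ} (hM : 0 ≤ M) {h hb : ℤ → A} {b bb : ℤ → ℂ}
    (hyp : FFDHyp M h hb b bb) (hac : ACRel M h hb) (k : ℕ) :
    ∑ p ∈ pairs M.toNat k, comm h hb p = 0 := by
  rw [← Finset.sum_filter_add_sum_filter_not _ (fun p => (nbrs p.1 p.2).card = 1),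
    sum_comm_of_card_nbrs_eq_one hM hyp k, zero_add,
    ← Finset.sum_filter_add_sum_filter_not _ (fun p => 3 ≤ (nbrs p.1 p.2).card)]
  have hthree : {p ∈ {p ∈ pairs M.toNat k | ¬(nbrs p.1 p.2).card = 1} |
      3 ≤ (nbrs p.1 p.2).card} = {p ∈ pairs M.toNat k | 3 ≤ (nbrs p.1 p.2).card} := by
    rw [Finset.filter_filter]
    refine Finset.filter_congr fun p _ => ?_
    omega
  rw [hthree, sum_comm_of_three_le_card_nbrs hM hyp hac k, zero_add]
  refine Finset.sum_eq_zero fun p hp => ?_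
  obtain ⟨v, S⟩ := p
  rw [Finset.mem_filter, Finset.mem_filter, mem_pairs] at hp
  obtain ⟨⟨⟨hv, -, hS⟩, h1⟩, h3⟩ := hp
  have heven : (nbrs v S).card = 0 ∨ (nbrs v S).card = 2 := by simp only at h1 h3; omega
  unfold comm
  simp only
  rw [prodGen_mul_gen hM hyp hv hS]
  rcases heven with he | he <;> simp [he]

/-- For every integer `k ≥ 1`, the charge `Q_M^{(k)}` commutes with the
Hamiltonian `H_M = Q_M^{(1)}`. -/
theorem hamiltonian_commutes_with_charges
    {A : Type*} [Ring A] [Algebra ℂ A]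
    (M : ℤ) (hM : 4 ≤ M) (h hb : ℤ → A) (b bb : ℤ → ℂ)
    (hyp : FFDHyp M h hb b bb) (hac : ACRel M h hb) :
    ∀ k : ℤ, 1 ≤ k →
      Q h hb M 1 * Q h hb M k = Q h hb M k * Q h hb M 1 := by
  classical
  intro k hk
  have hsum := sum_comm_eq_zero (by omega) hyp hac k.toNat
  have hQ : ∀ j : ℤ, 1 ≤ j →
      Q h hb M j = ∑ S ∈ indepSets M.toNat j.toNat, prodGen h hb S := fun j hj => by
    rw [Q, if_neg (by omega), if_neg (by omega)]
  rw [hQ 1 le_rfl, hQ k hk, Int.toNat_one, ← sum_gen_eq_sum_indepSets_one, Finset.sum_mul_sum,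
    Finset.sum_mul_sum, Finset.sum_comm (s := indepSets _ _), ← sub_eq_zero,
    ← Finset.sum_sub_distrib]
  rw [pairs, Finset.sum_product] at hsum
  convert hsum using 2
  rw [← Finset.sum_sub_distrib]
  rfl

end FFD
end

section
/- For all integers k, l ≥ 0, the charges mutually commute: Q_M^{(k)} · Q_M^{(l)} = Q_M^{(l)} · Q_M^{(k)}. -/
namespace FFD

variable {A : Type*} [Ring A] [Algebra ℂ A]

section Chain

set_option linter.unusedSimpArgs false

theorem commute_step {u v s : ℂ} (huv : u + v ≠ 0) {S P Q : A} (hS : S * S = s • (1 : A))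
    (hPQ : P * Q = Q * P)
    (hE : u • ((S * P + P * S) * Q - Q * (S * P + P * S))
      + v • (P * (S * Q + Q * S) - (S * Q + Q * S) * P) = 0) :
    (P - u • (S * P + P * S)) * (Q - v • (S * Q + Q * S)) =
      (Q - v • (S * Q + Q * S)) * (P - u • (S * P + P * S)) := by
  have h0 : (S * P + P * S) * (S * Q + Q * S) = (S * Q + Q * S) * (S * P + P * S) := by
    refine sub_eq_zero.1 ((smul_eq_zero_iff_right huv).1 ?_)
    linear_combination (norm := skip) S * hE + hE * S + (u + v) • (P * hS * Q - Q * hS * P)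
      - u • (hS * (P * Q) - Q * P * hS) - v • (P * Q * hS - hS * (Q * P))
    simp only [mul_add, add_mul, mul_sub, sub_mul, smul_mul_assoc, mul_smul_comm, mul_assoc,
      mul_zero, zero_mul, mul_one, one_mul]
    module
  linear_combination (norm := skip) hPQ - hE + (u * v) • h0
  simp only [mul_add, add_mul, mul_sub, sub_mul, smul_mul_assoc, mul_smul_comm, mul_assoc,
      mul_zero, zero_mul]
  module

theorem G0_eq {u v : ℂ} {a b p q : A} (hab : a * b = b * a)
    (hD : u • (p * b - b * p) + v • (a * q - q * a) = 0) (hs : p * b + b * p = a * q + q * a) :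
    (2 * u) • (a * (b - v • q)) - (u + v) • (b * (a - u • p)) - (u - v) • ((a + u • p) * b)
      = 0 := by
  linear_combination (norm := skip) (u + v) • hab - u • hD + (u * v) • hs
  simp only [mul_add, add_mul, mul_sub, sub_mul, smul_mul_assoc, mul_smul_comm, mul_assoc]
  module

theorem G_alg {u v : ℂ} {S A' c t a2 b2 p2 q2 a3 b3 p3 q3 a4 b4 : A}
    (hp : S * p2 + p2 * S = (2 : ℂ) • (A' * a3)) (hq : S * q2 + q2 * S = (2 : ℂ) • (A' * b3))
    (hSa : S * a2 - a2 * S = (2 * u) • (c * a4)) (hSb : S * b2 - b2 * S = (2 * v) • (c * b4))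
    (ht : a2 * c = c * t)
    (h2 : a2 * b2 = b2 * a2)
    (hD2 : u • (p2 * b2 - b2 * p2) + v • (a2 * q2 - q2 * a2) = 0)
    (hs2 : p2 * b2 + b2 * p2 = a2 * q2 + q2 * a2)
    (h3 : a3 * b3 = b3 * a3)
    (hD3 : u • (p3 * b3 - b3 * p3) + v • (a3 * q3 - q3 * a3) = 0)
    (hs3 : p3 * b3 + b3 * p3 = a3 * q3 + q3 * a3)
    (hAa : a2 * A' = A' * (a3 + u • p3)) (hAb : b2 * A' = A' * (b3 + v • q3))
    (hb2 : b2 = b3 - v • q3) :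
    (2 * u) • (a2 * (b2 - v • q2 - v • (S * (b2 - v • q2) + (b2 - v • q2) * S)))
      - (u + v) • (b2 * (a2 - u • p2 - u • (S * (a2 - u • p2) + (a2 - u • p2) * S)))
      - (u - v) • ((a2 + u • p2 + u • (S * (a2 + u • p2) + (a2 + u • p2) * S)) * b2)
    = (2 * u * v) • (c * ((2 * u) • (a4 * b2) - (u + v) • (b4 * a2) - (u - v) • (t * b4)))
      - (2 * u * (u ^ 2 - v ^ 2)) • (A' * ((2 : ℂ) • (a3 * b3) + a3 * b2 - b2 * a3)) := by
  have h0 := G0_eq h2 hD2 hs2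
  have hE : (2 * v) • (a2 * (S * b2 + b2 * S)) - (u + v) • (b2 * (S * a2 + a2 * S))
      + (u - v) • ((S * a2 + a2 * S) * b2) =
      -(2 * v) • (c * ((2 * u) • (a4 * b2) - (u + v) • (b4 * a2) - (u - v) • (t * b4))) := by
    linear_combination (norm := skip) -(2 * v) • (hSa * b2) + (u - v) • (a2 * hSb)
      + (u + v) • (hSb * a2) + (u + v) • (S * h2 + h2 * S) + (2 * v * (u - v)) • (ht * b4)
    simp only [mul_add, add_mul, mul_sub, sub_mul, smul_mul_assoc, mul_smul_comm, mul_assoc]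
    module
  have hA : -(4 * v ^ 2) • (a2 * A' * b3) + (2 * u * (u + v)) • (b2 * A' * a3)
      + (2 * u * (u - v)) • (A' * a3 * b2) =
      (u ^ 2 - v ^ 2) • (A' * ((4 : ℂ) • (a3 * b3) + (2 : ℂ) • (a3 * b2 - b2 * a3))) := by
    rw [hAa, hAb, hb2]
    linear_combination (norm := skip) -(2 * u * (u + v) + 2 * (u ^ 2 - v ^ 2)) • (A' * h3)
       - (2 * v ^ 2) • (A' * hD3) - (2 * u * v ^ 2) • (A' * hs3)
    simp only [mul_add, add_mul, mul_sub, sub_mul, smul_mul_assoc, mul_smul_comm, mul_assoc,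
      smul_add, smul_sub, smul_neg, mul_zero, zero_mul]
    module
  linear_combination (norm := skip) h0 - u • hE - u • hA
    + (2 * u * v ^ 2) • (a2 * hq) - (u ^ 2 * (u + v)) • (b2 * hp)
    - (u ^ 2 * (u - v)) • (hp * b2)
  simp only [mul_add, add_mul, mul_sub, sub_mul, smul_mul_assoc, mul_smul_comm, mul_assoc,
    mul_zero, zero_mul]
  module

theorem H_alg {u v : ℂ} {S A' c a b p q p' q' α β a4 b4 : A}
    (hp : S * p' + p' * S = (2 : ℂ) • (A' * α)) (hq : S * q' + q' * S = (2 : ℂ) • (A' * β))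
    (hSa : S * a - a * S = (2 * u) • (c * a4)) (hSb : S * b - b * S = (2 * v) • (c * b4))
    (h : a * b = b * a)
    (hD : u • (p' * b - b * p') + v • (a * q' - q' * a) = 0)
    (hs : p' * b + b * p' = a * q' + q' * a)
    (h3 : α * β = β * α)
    (hD3 : u • (p * β - β * p) + v • (α * q - q * α) = 0)
    (hs3 : p * β + β * p = α * q + q * α)
    (hAa : a * A' = A' * (α + u • p)) (hAb : b * A' = A' * (β + v • q))
    (hb : b = β - v • q) :
    (2 * u) • (a * (b - v • q' - v • (S * (b - v • q') + (b - v • q') * S)))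
      - (2 * v) • (b * (a - u • p' - u • (S * (a - u • p') + (a - u • p') * S)))
      + (2 * u * v * (u - v)) • (A' * ((2 : ℂ) • (α * β) + α * b - b * α))
    = (4 * u * v) • (c * (u • (a4 * b) - v • (b4 * a)))
      + (u - v) • ((2 : ℂ) • (a * b) + a * (b - v • q') - (b - v • q') * a) := by
  have hA : (4 * u * v ^ 2) • (a * A' * β) - (4 * u ^ 2 * v) • (b * A' * α)
      + (2 * u * v * (u - v)) • (A' * ((2 : ℂ) • (α * β) + α * b - b * α)) = 0 := by
    rw [hAa, hAb, hb]
    linear_combination (norm := skip) (4 * u ^ 2 * v + 2 * u * v * (u - v)) • (A' * h3)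
       + (2 * u * v ^ 2) • (A' * hD3) + (2 * u ^ 2 * v ^ 2) • (A' * hs3)
    simp only [mul_add, add_mul, mul_sub, sub_mul, smul_mul_assoc, mul_smul_comm, mul_assoc,
      smul_add, smul_sub, smul_neg, mul_zero, zero_mul]
    module
  linear_combination (norm := skip) hA + (2 * u * v ^ 2) • (a * hq) - (2 * v * u ^ 2) • (b * hp)
    + (2 * u * v) • (hSa * b - hSb * a - S * h - h * S) + (3 * v - u) • h - v • hD + (u * v) • hs
  simp only [mul_add, add_mul, mul_sub, sub_mul, smul_mul_assoc, mul_smul_comm, mul_assoc,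
    mul_zero, zero_mul]
  module

theorem FC_alg {u v : ℂ} {S C G P Q t a b : A} (hPC : P * C = C * t) (hSC : S * C = C * S)
    (hSa : S * a = a * S) (hSb : S * b = b * S)
    (hG : G = (2 * u) • (a * Q) - (u + v) • (b * P) - (u - v) • (t * b))
    (hSG : S * G + G * S = 0) :
    (2 * u) • (C * a * (Q - u • (S * Q + Q * S))) - (u + v) • (C * b * (P - u • (S * P + P * S)))
      - (u - v) • ((P - u • (S * P + P * S)) * (C * b)) = C * G := by
  have hpC : (S * P + P * S) * C = C * (S * t + t * S) := by
    linear_combination (norm := skip) S * hPC + hSC * t + P * hSC + hPC * S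
    simp only [mul_add, add_mul, mul_sub, sub_mul, smul_mul_assoc, mul_smul_comm, mul_assoc]
    module
  have hSG' : C * (S * G + G * S) = 0 := by rw [hSG, mul_zero]
  subst hG
  linear_combination (norm := skip) -(u - v) • (hPC * b - u • hpC * b)
    - u • hSG' + (2 * u ^ 2) • (C * hSa * Q) - (u * (u + v)) • (C * hSb * P)
    + (u * (u - v)) • (C * t * hSb)
  simp only [mul_add, add_mul, mul_sub, sub_mul, smul_mul_assoc, mul_smul_comm, mul_assoc,
    mul_zero, zero_mul]
  module

theorem FA_alg {u v : ℂ} {S T A' C G t a b a3 b3 : A}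
    (hPA : (a - u • (T * a + a * T)) * A' = A' * (a + u • (T * a + a * T)))
    (hSA : S * A' = A' * S)
    (hab : a * b = b * a)
    (hD : u • ((T * a + a * T) * b - b * (T * a + a * T))
      + v • (a * (T * b + b * T) - (T * b + b * T) * a) = 0)
    (hSa : S * a - a * S = (2 * u) • (C * a3)) (hSb : S * b - b * S = (2 * v) • (C * b3))
    (hTC : T * C = C * T) (hTa : T * a3 = a3 * T) (hTb : T * b3 = b3 * T)
    (haC : a * C = C * t)
    (hG : G = (2 * u) • (a3 * b) - (u + v) • (b3 * a) - (u - v) • (t * b3))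
    (hTG : T * G + G * T = 0) (P Q : A) (hP : P = a - u • (T * a + a * T))
    (hQ : Q = b - v • (T * b + b * T)) :
    (2 * u) • (A' * a * (Q - u • (S * Q + Q * S))) - (u + v) • (A' * b * (P - u • (S * P + P * S)))
      - (u - v) • ((P - u • (S * P + P * S)) * (A' * b)) =
    (2 * u) • (A' * (C * ((2 * u * (u + v)) • (a3 * b) - (2 * v * (u + v)) • (b3 * a) - v • G))) := by
  have hs : (T * a + a * T) * b + b * (T * a + a * T) = a * (T * b + b * T) + (T * b + b * T) * a := by
    linear_combination (norm := skip) T * hab - hab * T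
    simp only [mul_add, add_mul, mul_sub, sub_mul, smul_mul_assoc, mul_smul_comm, mul_assoc]
    module
  have h0 := G0_eq hab hD hs
  rw [← hP, ← hQ] at h0
  rw [← hP] at hPA
  obtain ⟨r, hr⟩ : ∃ r, r = a + u • (T * a + a * T) := ⟨_, rfl⟩
  rw [← hr] at h0 hPA
  have hpA : (S * P + P * S) * A' = A' * (S * r + r * S) := by
    linear_combination (norm := skip) S * hPA + hSA * r + P * hSA + hPA * S
    simp only [mul_add, add_mul, mul_sub, sub_mul, smul_mul_assoc, mul_smul_comm, mul_assoc]
    module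
  have h1 : (2 * u) • (A' * a * (Q - u • (S * Q + Q * S)))
      - (u + v) • (A' * b * (P - u • (S * P + P * S)))
      - (u - v) • ((P - u • (S * P + P * S)) * (A' * b)) =
      (2 * u) • (A' * ((2 * u ^ 2) • (C * a3 * Q) - (v * (u + v)) • (C * b3 * P)
        + (v * (u - v)) • (r * C * b3))) := by
    have h0' : A' * ((2 * u) • (a * Q) - (u + v) • (b * P) - (u - v) • (r * b)) = 0 := by
      rw [h0, mul_zero]
    have h0S := congrArg (fun Z => A' * (S * Z + Z * S)) h0
    simp only [mul_zero, zero_mul, add_zero] at h0S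
    linear_combination (norm := skip) h0' - u • h0S - (u - v) • (hPA * b - u • hpA * b)
      + (2 * u ^ 2) • (A' * hSa * Q) - (u * (u + v)) • (A' * hSb * P)
      + (u * (u - v)) • (A' * r * hSb)
    simp only [mul_add, add_mul, mul_sub, sub_mul, smul_mul_assoc, mul_smul_comm, mul_assoc,
      mul_zero, zero_mul]
    module
  rw [h1]
  congr 2
  have hTG' : C * (T * G + G * T) = 0 := by rw [hTG, mul_zero]
  subst hP hQ hr hG
  linear_combination (norm := skip) (v * (u - v)) • (haC * b3 + u • (T * haC * b3 + hTC * (t * b3))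
    + u • (haC * T * b3) + u • (a * hTC * b3)) - (u * v) • hTG' + (2 * u ^ 2 * v) • (C * hTa * b)
    - (u * v * (u + v)) • (C * hTb * a) + (u * v * (u - v)) • (C * t * hTb)
  simp only [mul_add, add_mul, mul_sub, sub_mul, smul_mul_assoc, mul_smul_comm, mul_assoc,
      mul_zero, zero_mul]
  module

theorem edge_step {u v : ℂ} {Z P Q p q α β γ δ : A} (hPQ : P * Q = Q * P)
    (hc : (P - u • p) * (Q - v • q) = (Q - v • q) * (P - u • p))
    (hD : u • (p * Q - Q * p) + v • (P * q - q * P) = 0)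
    (hs : p * Q + Q * p = P * q + q * P)
    (hP : P * Z = Z * P - (2 * u) • α) (hp : p * Z = -(Z * p) + (2 : ℂ) • β)
    (hQ : Q * Z = Z * Q - (2 * v) • γ) (hq : q * Z = -(Z * q) + (2 : ℂ) • δ)
    (hF : (2 * u) • ((α + β) * (Q - u • q)) =
      (u + v) • ((γ + δ) * (P - u • p)) + (u - v) • ((P - u • p) * (γ + δ))) :
    (u + v) • ((P - u • p) * Z * (Q - v • q) - (Q - v • q) * Z * (P - u • p))
      + (u - v) • (Z * ((P - u • p) * (Q - v • q)) - (P - u • p) * (Q - v • q) * Z) = 0 := by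
  have h1 : (P - u • p) * Z = Z * (P + u • p) - (2 * u) • (α + β) := by
    linear_combination (norm := skip) hP - u • hp
    simp only [mul_add, add_mul, mul_sub, sub_mul, smul_mul_assoc, mul_smul_comm, mul_assoc]
    module
  have h2 : (Q - v • q) * Z = Z * (Q + v • q) - (2 * v) • (γ + δ) := by
    linear_combination (norm := skip) hQ - v • hq
    simp only [mul_add, add_mul, mul_sub, sub_mul, smul_mul_assoc, mul_smul_comm, mul_assoc]
    module
  have h3 : (u + v) • ((P + u • p) * (Q - v • q) - (Q + v • q) * (P - u • p))
      + (u - v) • ((P - u • p) * (Q - v • q) - (P + u • p) * (Q + v • q)) = 0 := by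
    linear_combination (norm := skip) (2*(u + v)) • hPQ - (u + v) • hc - (2 * u) • hD + (2*u*v) • hs
    simp only [mul_add, add_mul, mul_sub, sub_mul, smul_mul_assoc, mul_smul_comm, mul_assoc]
    module
  linear_combination (norm := skip) (u + v) • (h1 * (Q - v • q) - h2 * (P - u • p))
    - (u - v) • ((P - u • p) * h2 + h1 * (Q + v • q)) + Z * h3 - (2 * v) • hF
  simp only [mul_add, add_mul, mul_sub, sub_mul, smul_mul_assoc, mul_smul_comm, mul_assoc, mul_zero]
  module

/-- The relations between the clique sums `S n` and the operators `a n = {S n, S (n-1)}`,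
`c n = [S (n-1), S (n+1)]` used for the commutation of the transfer matrices. -/
structure CliqueChain (S a c : ℤ → A) (s : ℤ → ℂ) : Prop where
  sq : ∀ n, S n * S n = s n • (1 : A)
  zero : ∀ n < 0, S n = 0
  anticomm_S : ∀ n, S n * S (n - 1) + S (n - 1) * S n = a n
  comm_S : ∀ n, S (n - 2) * S n - S n * S (n - 2) = c (n - 1)
  S_far : ∀ n k, k ≤ n - 3 → S n * S k = S k * S n
  a_S : ∀ n, a n * S (n - 2) = -(S (n - 2) * a n)
  S_a : ∀ n, S n * a (n - 1) = -(a (n - 1) * S n)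
  a_far : ∀ n k, k ≤ n - 3 → a n * S k = S k * a n
  c_S : ∀ n, c n * S n = S n * c n
  c_S_one : ∀ n, c n * S (n - 1) = -(S (n - 1) * c n)
  c_S_two : ∀ n, c n * S (n - 2) = -(S (n - 2) * c n)
  S_c : ∀ n, S n * c (n - 2) = -(c (n - 2) * S n)
  c_far : ∀ n k, k ≤ n - 3 → c n * S k = S k * c n
  ac : ∀ n, c (n - 1) * a (n - 2) = a n * c (n - 2)

/-- The recursion of the transfer matrices along the clique sums `S n`. -/
structure IsTransfer (S : ℤ → A) (u : ℂ) (x : ℤ → A) : Prop where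
  low : ∀ n < 0, x n = 1
  step : ∀ n, x n = x (n - 1) - u • (S n * x (n - 1) + x (n - 1) * S n)

variable {S a c : ℤ → A} {s : ℤ → ℂ} {u v : ℂ} {x y : ℤ → A}

theorem IsTransfer.commute_of_forall (hx : IsTransfer S u x) {z : A} {n : ℤ}
    (hz : ∀ k ≤ n, z * S k = S k * z) : z * x n = x n * z := by
  rcases lt_or_ge n 0 with hn | hn
  · simp [hx.low n hn]
  · obtain ⟨m, rfl⟩ : ∃ m : ℕ, n = (m : ℤ) - 1 := ⟨(n + 1).toNat, by omega⟩
    clear hn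
    induction m with
    | zero => simp [hx.low]
    | succ m ih =>
      have ih' := ih fun k hk => hz k (by push_cast; omega)
      have h1 := hz _ le_rfl
      rw [hx.step]
      rw [show ((m + 1 : ℕ) : ℤ) - 1 - 1 = (m : ℤ) - 1 by push_cast; ring]
      set X := x ((m : ℤ) - 1)
      set T := S (((m + 1 : ℕ) : ℤ) - 1)
      linear_combination (norm := skip) ih' - u • (h1 * X + T * ih' + ih' * T + X * h1)
      simp only [mul_add, add_mul, mul_sub, sub_mul, smul_mul_assoc, mul_smul_comm, mul_assoc]
      module

theorem IsTransfer.S_comm (hS : CliqueChain S a c s) (hx : IsTransfer S u x) {n k : ℤ}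
    (h : k ≤ n - 3) : S n * x k = x k * S n :=
  hx.commute_of_forall fun j hj => hS.S_far n j (by omega)

theorem IsTransfer.a_comm (hS : CliqueChain S a c s) (hx : IsTransfer S u x) {n k : ℤ}
    (h : k ≤ n - 3) : a n * x k = x k * a n :=
  hx.commute_of_forall fun j hj => hS.a_far n j (by omega)

theorem IsTransfer.c_comm (hS : CliqueChain S a c s) (hx : IsTransfer S u x) {n k : ℤ}
    (h : k ≤ n - 3) : c n * x k = x k * c n :=
  hx.commute_of_forall fun j hj => hS.c_far n j (by omega)

theorem CliqueChain.a_S_one (hS : CliqueChain S a c s) (n : ℤ) :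
    S (n - 1) * a n = a n * S (n - 1) := by
  have h := hS.sq (n - 1)
  rw [← hS.anticomm_S n]
  linear_combination (norm := skip) h * S n - S n * h
  simp only [mul_add, add_mul, mul_sub, sub_mul, smul_mul_assoc, mul_smul_comm, mul_assoc,
    mul_one, one_mul]
  module

theorem CliqueChain.a_zero (hS : CliqueChain S a c s) {n : ℤ} (hn : n ≤ 0) : a n = 0 := by
  rw [← hS.anticomm_S, hS.zero (n - 1) (by omega)]
  simp

/-- Conjugation of `x (n-2)` by `c n`. -/
theorem IsTransfer.mul_c (hS : CliqueChain S a c s) (hx : IsTransfer S u x) (n : ℤ) :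
    x (n - 2) * c n =
      c n * (x (n - 3) + u • (S (n - 2) * x (n - 3) + x (n - 3) * S (n - 2))) := by
  have h1 := hx.c_comm hS (le_refl (n - 3))
  have h2 := hS.c_S_two n
  have h3 := hx.step (n - 2)
  rw [sub_sub, show (2 : ℤ) + 1 = 3 by norm_num] at h3
  rw [h3]
  linear_combination (norm := skip) -h1 - u • (-(S (n - 2) * h1) + h2 * x (n - 3)
    + x (n - 3) * h2 + h1 * S (n - 2))
  simp only [mul_add, add_mul, mul_sub, sub_mul, smul_mul_assoc, mul_smul_comm, mul_assoc, mul_neg,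
    neg_mul]
  module

/-- Conjugation of `x (n-1)` by `c n`, in terms of the conjugate of `x (n-2)`. -/
theorem IsTransfer.mul_c' (hS : CliqueChain S a c s) (hx : IsTransfer S u x) (n : ℤ) {t : A}
    (ht : x (n - 2) * c n = c n * t) :
    x (n - 1) * c n = c n * (t + u • (S (n - 1) * t + t * S (n - 1))) := by
  have h2 := hS.c_S_one n
  have h3 := hx.step (n - 1)
  rw [sub_sub, show (1 : ℤ) + 1 = 2 by norm_num] at h3
  rw [h3]
  linear_combination (norm := skip) ht - u • (S (n - 1) * ht + h2 * t
    + x (n - 2) * h2 - ht * S (n - 1))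
  simp only [mul_add, add_mul, mul_sub, sub_mul, smul_mul_assoc, mul_smul_comm, mul_assoc, mul_neg,
    neg_mul]
  module

theorem IsTransfer.mul_a (hS : CliqueChain S a c s) (hx : IsTransfer S u x) (n : ℤ) :
    x (n - 2) * a n =
      a n * (x (n - 3) + u • (S (n - 2) * x (n - 3) + x (n - 3) * S (n - 2))) := by
  have h1 := hx.a_comm hS (le_refl (n - 3))
  have h2 := hS.a_S n
  have h3 := hx.step (n - 2)
  rw [sub_sub, show (2 : ℤ) + 1 = 3 by norm_num] at h3
  rw [h3]
  linear_combination (norm := skip) -h1 - u • (-(S (n - 2) * h1) + h2 * x (n - 3)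
    + x (n - 3) * h2 + h1 * S (n - 2))
  simp only [mul_add, add_mul, mul_sub, sub_mul, smul_mul_assoc, mul_smul_comm, mul_assoc, mul_neg,
    neg_mul]
  module

theorem IsTransfer.S_commutator (hS : CliqueChain S a c s) (hx : IsTransfer S u x) (n : ℤ) :
    S n * x (n - 2) - x (n - 2) * S n = (2 * u) • (c (n - 1) * x (n - 4)) := by
  have h1 := hx.S_comm hS (le_refl (n - 3))
  have h2 := hS.comm_S n
  have h3 := hx.step (n - 2)
  have h4 := hx.mul_c hS (n - 1)
  have h5 := hx.step (n - 3)
  simp only [sub_sub, Int.reduceAdd] at h3 h4 h5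
  rw [h3]
  linear_combination (norm := skip) h1 - u • (S (n - 2) * h1 + h1 * S (n - 2) - h2 * x (n - 3)
     - x (n - 3) * h2) + u • h4 + u • (c (n - 1) * h5)
  simp only [mul_add, add_mul, mul_sub, sub_mul, smul_mul_assoc, mul_smul_comm, mul_assoc, mul_neg,
    neg_mul]
  module

theorem IsTransfer.S_anticomm (hS : CliqueChain S a c s) (hx : IsTransfer S u x) (n : ℤ) :
    S n * (S (n - 1) * x (n - 2) + x (n - 2) * S (n - 1))
      + (S (n - 1) * x (n - 2) + x (n - 2) * S (n - 1)) * S n = (2 : ℂ) • (a n * x (n - 3)) := by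
  rcases lt_or_ge n 0 with hn | hn
  · simp [hS.zero n hn, hS.a_zero hn.le]
  · obtain ⟨m, rfl⟩ : ∃ m : ℕ, n = (m : ℤ) - 1 := ⟨(n + 1).toNat, by omega⟩
    clear hn
    induction m with
    | zero => simp [hS.zero, hS.a_zero]
    | succ m ih =>
      rw [show ((m + 1 : ℕ) : ℤ) - 1 = m by push_cast; ring]
      generalize (m : ℤ) = n at *
      have h1 := hx.S_comm hS (le_refl (n - 3))
      have h2 := hS.anticomm_S n
      have h3 := hx.a_comm hS (le_refl (n - 3))
      have h4 := hx.step (n - 2)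
      have h5 := hx.S_comm hS (n := n) (k := n - 4) (by omega)
      have h6 := hS.S_a n
      simp only [sub_sub, Int.reduceAdd] at h4 ih
      rw [h4]
      linear_combination (norm := skip) h2 * x (n - 3) + x (n - 3) * h2 - h3
        - S (n - 1) * h1 + h1 * S (n - 1)
        - u • (S n * ih + ih * S n) - (2 * u) • (h6 * x (n - 4) - a (n - 1) * h5)
      simp only [mul_add, add_mul, mul_sub, sub_mul, smul_mul_assoc, mul_smul_comm, mul_assoc,
        mul_neg, neg_mul]
      module

/-- The linear part of the commutation relation of the transfer matrices at level `n`. -/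
def LinRel (S : ℤ → A) (u v : ℂ) (x y : ℤ → A) (n : ℤ) : Prop :=
  u • ((S n * x (n - 1) + x (n - 1) * S n) * y (n - 1)
      - y (n - 1) * (S n * x (n - 1) + x (n - 1) * S n))
    + v • (x (n - 1) * (S n * y (n - 1) + y (n - 1) * S n)
      - (S n * y (n - 1) + y (n - 1) * S n) * x (n - 1)) = 0

theorem symm_rel {A : Type*} [Ring A] {S P Q : A} (h : P * Q = Q * P) :
    (S * P + P * S) * Q + Q * (S * P + P * S) = P * (S * Q + Q * S) + (S * Q + Q * S) * P := by
  linear_combination (norm := skip) S * h - h * S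
  simp only [mul_add, add_mul, mul_sub, sub_mul, smul_mul_assoc, mul_smul_comm, mul_assoc]
  module

/-- The conjugate of `x (n-2)` by `c (n-1)`. -/
def conjC (S : ℤ → A) (u : ℂ) (x : ℤ → A) (n : ℤ) : A :=
  x (n - 4) + u • (S (n - 3) * x (n - 4) + x (n - 4) * S (n - 3))
    + u • (S (n - 2) * (x (n - 4) + u • (S (n - 3) * x (n - 4) + x (n - 4) * S (n - 3)))
      + (x (n - 4) + u • (S (n - 3) * x (n - 4) + x (n - 4) * S (n - 3))) * S (n - 2))

theorem IsTransfer.mul_conjC (hS : CliqueChain S a c s) (hx : IsTransfer S u x) (n : ℤ) :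
    x (n - 2) * c (n - 1) = c (n - 1) * conjC S u x n := by
  have h := hx.mul_c' hS (n - 1) (hx.mul_c hS (n - 1))
  simp only [sub_sub, Int.reduceAdd] at h
  exact h

/-- The bilinear defect multiplying `c (n-1)`. -/
def defectC (S : ℤ → A) (u v : ℂ) (x y : ℤ → A) (n : ℤ) : A :=
  (2 * u) • (x (n - 4) * y (n - 2)) - (u + v) • (y (n - 4) * x (n - 2))
    - (u - v) • (conjC S u x n * y (n - 4))

/-- The bilinear defect multiplying `a n * c (n-2)`. -/
def defectA (S : ℤ → A) (u v : ℂ) (x y : ℤ → A) (n : ℤ) : A :=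
  (2 * u * (u + v)) • (x (n - 5) * y (n - 3)) - (2 * v * (u + v)) • (y (n - 5) * x (n - 3))
    - v • defectC S u v x y (n - 1)

/-- The inhomogeneity in the recursion of the defects. -/
def defectY (x y : ℤ → A) (n : ℤ) : A :=
  (2 : ℂ) • (x (n - 5) * y (n - 5)) + x (n - 5) * y (n - 4) - y (n - 4) * x (n - 5)

theorem defectC_rec (hS : CliqueChain S a c s) (hx : IsTransfer S u x) (hy : IsTransfer S v y)
    {n : ℤ} (hD : ∀ k < n, LinRel S u v x y k) (hc : ∀ k < n, x k * y k = y k * x k) :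
    defectC S u v x y n = (2 * u * v) • (c (n - 3) * defectC S u v x y (n - 2))
      - (2 * u * (u ^ 2 - v ^ 2)) • (a (n - 2) * defectY x y n) := by
  have hp := hx.S_anticomm hS (n - 2)
  have hq := hy.S_anticomm hS (n - 2)
  have hSa := hx.S_commutator hS (n - 2)
  have hSb := hy.S_commutator hS (n - 2)
  have ht := hx.mul_conjC hS (n - 2)
  have hD2 := hD (n - 3) (by omega)
  have hD3 := hD (n - 4) (by omega)
  have hAa := hx.mul_a hS (n - 2)
  have hAb := hy.mul_a hS (n - 2)
  have hb2 := hy.step (n - 4)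
  have hx2 := hx.step (n - 2)
  have hx3 := hx.step (n - 3)
  have hy2 := hy.step (n - 2)
  have hy3 := hy.step (n - 3)
  unfold LinRel at hD2 hD3
  unfold defectC defectY
  simp only [sub_sub n, Int.reduceAdd] at *
  have h := G_alg hp hq hSa hSb ht (hc _ (by omega)) hD2 (symm_rel (hc _ (by omega)))
    (hc _ (by omega)) hD3 (symm_rel (hc _ (by omega))) hAa hAb hb2
  rw [← hx3, ← hy3, ← hx2, ← hy2] at h
  exact h

theorem defectA_rec (hS : CliqueChain S a c s) (hx : IsTransfer S u x) (hy : IsTransfer S v y)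
    {n : ℤ} (hD : ∀ k < n, LinRel S u v x y k) (hc : ∀ k < n, x k * y k = y k * x k) :
    defectA S u v x y n = (2 * u * v) • (c (n - 4) * defectA S u v x y (n - 2))
      + (u ^ 2 - v ^ 2) • defectY x y n := by
  have hp := hx.S_anticomm hS (n - 3)
  have hq := hy.S_anticomm hS (n - 3)
  have hSa := hx.S_commutator hS (n - 3)
  have hSb := hy.S_commutator hS (n - 3)
  have hD2 := hD (n - 4) (by omega)
  have hD3 := hD (n - 5) (by omega)
  have hAa := hx.mul_a hS (n - 3)
  have hAb := hy.mul_a hS (n - 3)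
  have hb := hy.step (n - 5)
  have hx3 := hx.step (n - 3)
  have hx4 := hx.step (n - 4)
  have hy3 := hy.step (n - 3)
  have hy4 := hy.step (n - 4)
  have hC := defectC_rec hS hx hy (n := n - 1) (fun k hk => hD k (by omega))
    (fun k hk => hc k (by omega))
  unfold LinRel at hD2 hD3
  unfold defectA
  unfold defectY at *
  simp only [sub_sub n, Int.reduceAdd] at *
  have h := H_alg hp hq hSa hSb (hc _ (by omega)) hD2 (symm_rel (hc _ (by omega)))
    (hc _ (by omega)) hD3 (symm_rel (hc _ (by omega))) hAa hAb hb
  rw [← hx4, ← hy4, ← hx3, ← hy3] at h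
  linear_combination (norm := skip) (u + v) • h - v • hC
  simp only [mul_add, add_mul, mul_sub, sub_mul, smul_mul_assoc, mul_smul_comm, mul_assoc]
  module

theorem defectC_eq (hS : CliqueChain S a c s) (hx : IsTransfer S u x) (hy : IsTransfer S v y)
    {n : ℤ} (hD : ∀ k < n, LinRel S u v x y k) (hc : ∀ k < n, x k * y k = y k * x k) :
    defectC S u v x y n = -(2 * u) • (a (n - 2) * defectA S u v x y n) := by
  obtain ⟨m, hm⟩ : ∃ m : ℕ, n < 2 * m := ⟨(n + 1).toNat, by omega⟩
  induction m generalizing n with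
  | zero =>
    have h1 : conjC S u x n = 1 := by
      simp [conjC, hS.zero (n - 2) (by omega), hS.zero (n - 3) (by omega),
        hx.low (n - 4) (by omega)]
    simp only [defectC, h1, hx.low (n - 4) (by omega), hx.low (n - 2) (by omega),
      hy.low (n - 4) (by omega), hy.low (n - 2) (by omega), hS.a_zero (n := n - 2) (by omega)]
    simp only [mul_one, zero_mul, smul_zero]
    module
  | succ m ih =>
    have h1 := ih (n := n - 2) (fun k hk => hD k (by omega)) (fun k hk => hc k (by omega))
      (by push_cast at hm; omega)
    have h2 := defectC_rec hS hx hy hD hc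
    have h3 := defectA_rec hS hx hy hD hc
    have h4 := hS.ac (n - 2)
    simp only [sub_sub, Int.reduceAdd] at h1 h4
    rw [h2, h3, h1]
    linear_combination (norm := skip) -(4 * u ^ 2 * v) • (h4 * defectA S u v x y (n - 2))
    simp only [mul_add, add_mul, mul_sub, sub_mul, smul_mul_assoc, mul_smul_comm, mul_assoc]
    module

theorem S_defectC (hS : CliqueChain S a c s) (hx : IsTransfer S u x) (hy : IsTransfer S v y)
    {n : ℤ} (hD : ∀ k < n, LinRel S u v x y k) (hc : ∀ k < n, x k * y k = y k * x k) :
    S (n - 1) * defectC S u v x y n + defectC S u v x y n * S (n - 1) = 0 := by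
  have hSx : ∀ k ≤ n - 4, Commute (S (n - 1)) (x k) := fun k hk => hx.S_comm hS (by omega)
  have hSy : ∀ k ≤ n - 4, Commute (S (n - 1)) (y k) := fun k hk => hy.S_comm hS (by omega)
  have hSS : ∀ k ≤ n - 4, Commute (S (n - 1)) (S k) := fun k hk => hS.S_far _ _ (by omega)
  have hY : Commute (S (n - 1)) (defectY x y n) := by
    have h1 := hSx (n - 5) (by omega)
    have h2 := hSy (n - 5) (by omega)
    have h3 := hSy (n - 4) (by omega)
    exact (((h1.mul_right h2).smul_right _).add_right (h1.mul_right h3)).sub_right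
      (h3.mul_right h1)
  have hG : Commute (S (n - 1)) (defectC S u v x y (n - 2)) := by
    have h1 := hSx (n - 2 - 4) (by omega)
    have h2 := hSx (n - 2 - 2) (by omega)
    have h3 := hSy (n - 2 - 4) (by omega)
    have h4 := hSy (n - 2 - 2) (by omega)
    have h5 := hSS (n - 2 - 3) (by omega)
    have h6 := hSS (n - 2 - 2) (by omega)
    have h7 := h1.add_right (((h5.mul_right h1).add_right (h1.mul_right h5)).smul_right u)
    have h8 : Commute (S (n - 1)) (conjC S u x (n - 2)) :=
      h7.add_right (((h6.mul_right h7).add_right (h7.mul_right h6)).smul_right u)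
    exact (((h1.mul_right h4).smul_right _).sub_right ((h3.mul_right h2).smul_right _)).sub_right
      ((h8.mul_right h3).smul_right _)
  have h1 := hS.S_a (n - 1)
  have h2 := hS.S_c (n - 1)
  simp only [sub_sub, Int.reduceAdd] at h1 h2
  rw [defectC_rec hS hx hy hD hc]
  have hY' := hY.eq
  have hG' := hG.eq
  set W := defectC S u v x y (n - 2)
  set Y := defectY x y n
  linear_combination (norm := skip) (2 * u * v) • (h2 * W - c (n - 3) * hG') -
    (2 * u * (u ^ 2 - v ^ 2)) • (h1 * Y - a (n - 2) * hY')
  simp only [mul_add, add_mul, mul_sub, sub_mul, smul_mul_assoc, mul_smul_comm, mul_assoc, neg_mul]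
  module

theorem linRel_step (hS : CliqueChain S a c s) (hx : IsTransfer S u x) (hy : IsTransfer S v y)
    {n : ℤ} (hD : ∀ k < n, LinRel S u v x y k) (hc : ∀ k < n, x k * y k = y k * x k) :
    LinRel S u v x y n := by
  have hGC := S_defectC hS hx hy hD hc
  have hGA := S_defectC hS hx hy (n := n - 1) (fun k hk => hD k (by omega))
    (fun k hk => hc k (by omega))
  have hGH := defectC_eq hS hx hy hD hc
  have ac := hS.ac n
  have hPC := hx.mul_conjC hS n
  have hPC1 := hx.mul_conjC hS (n - 1)
  have hSC := hS.c_S (n - 1)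
  have hSC2 := hS.c_S (n - 2)
  have hSa := hx.S_comm hS (n := n - 1) (k := n - 4) (by omega)
  have hSb := hy.S_comm hS (n := n - 1) (k := n - 4) (by omega)
  have hTa := hx.S_comm hS (n := n - 2) (k := n - 5) (by omega)
  have hTb := hy.S_comm hS (n := n - 2) (k := n - 5) (by omega)
  have hS1a := hx.S_commutator hS (n - 1)
  have hS1b := hy.S_commutator hS (n - 1)
  have hS0a := hx.S_commutator hS n
  have hS0b := hy.S_commutator hS n
  have hx1 := hx.step (n - 1)
  have hx2 := hx.step (n - 2)
  have hy1 := hy.step (n - 1)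
  have hy2 := hy.step (n - 2)
  have hp := hx.S_anticomm hS n
  have hq := hy.S_anticomm hS n
  have hPA := hx.mul_a hS n
  have hSA := hS.a_S_one n
  have hD1 := hD (n - 1) (by omega)
  have hD2 := hD (n - 2) (by omega)
  unfold LinRel at *
  simp only [sub_sub n, Int.reduceAdd] at *
  have hC := FC_alg (u := u) (v := v) hPC hSC.symm hSa hSb rfl hGC
  have hdC : defectC S u v x y n = (2 * u) • (x (n - 4) * y (n - 2))
    - (u + v) • (y (n - 4) * x (n - 2)) - (u - v) • (conjC S u x n * y (n - 4)) := rfl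
  rw [← hdC] at hC
  have hA := FA_alg (by rwa [hx2] at hPA) hSA (hc _ (by omega)) hD2 hS1a hS1b hSC2.symm hTa hTb
    hPC1 (by simp only [defectC, sub_sub n, Int.reduceAdd]) hGA _ _ hx2 hy2
  have hdA : defectA S u v x y n = (2 * u * (u + v)) • (x (n - 5) * y (n - 3))
    - (2 * v * (u + v)) • (y (n - 5) * x (n - 3)) - v • defectC S u v x y (n - 1) := rfl
  rw [← hdA] at hA
  have hF : (2 * u) • ((c (n - 1) * x (n - 4) + a n * x (n - 3)) *
      (y (n - 2) - u • (S (n - 1) * y (n - 2) + y (n - 2) * S (n - 1)))) =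
      (u + v) • ((c (n - 1) * y (n - 4) + a n * y (n - 3)) *
        (x (n - 2) - u • (S (n - 1) * x (n - 2) + x (n - 2) * S (n - 1))))
      + (u - v) • ((x (n - 2) - u • (S (n - 1) * x (n - 2) + x (n - 2) * S (n - 1))) *
        (c (n - 1) * y (n - 4) + a n * y (n - 3))) := by
    linear_combination (norm := skip) hC + hA + c (n - 1) * hGH
      - (2 * u) • (ac * defectA S u v x y n)
    simp only [mul_add, add_mul, mul_sub, sub_mul, smul_mul_assoc, mul_smul_comm, mul_assoc]
    module
  have hcomm := hc (n - 1) (by omega)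
  rw [hx1, hy1] at hcomm
  have h := edge_step (Z := S n) (hc (n - 2) (by omega)) hcomm hD1 (symm_rel (hc _ (by omega)))
    (by rw [← hS0a]; abel) (by rw [← hp]; abel) (by rw [← hS0b]; abel) (by rw [← hq]; abel) hF
  rw [← hx1, ← hy1] at h
  rw [← hx1, ← hy1] at hcomm
  linear_combination (norm := skip) h + v • (S n * hcomm) + u • (hcomm * S n)
  simp only [mul_add, add_mul, mul_sub, sub_mul, smul_mul_assoc, mul_smul_comm, mul_assoc]
  module

/-- The transfer matrices along a clique chain commute. -/
theorem IsTransfer.commute (hS : CliqueChain S a c s) (huv : u + v ≠ 0) (hx : IsTransfer S u x)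
    (hy : IsTransfer S v y) (n : ℤ) : x n * y n = y n * x n := by
  suffices h : ∀ m : ℕ, ∀ n : ℤ, n < m → LinRel S u v x y n ∧ x n * y n = y n * x n from
    (h (n + 1).toNat n (by omega)).2
  intro m
  induction m with
  | zero =>
    intro n hn
    simp only [Nat.cast_zero] at hn
    simp [LinRel, hS.zero n hn, hx.low n hn]
  | succ m ih =>
    intro n hn
    have hn' : n ≤ m := by push_cast at hn; omega
    have hD := linRel_step (n := n) hS hx hy (fun k hk => (ih k (by omega)).1)
      (fun k hk => (ih k (by omega)).2)
    refine ⟨hD, ?_⟩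
    have := commute_step huv (hS.sq n) (ih (n - 1) (by omega)).2 hD
    rwa [← hx.step, ← hy.step] at this

end Chain

/-- Adjacency of vertex codes, in a form uniform in the parity of the codes. -/
def CodeAdj (v w : ℤ) : Prop :=
  (v % 2 = 0 ∧ w % 2 = 0 ∧ v ≠ w ∧ v - w ≤ 4 ∧ w - v ≤ 4) ∨
  (v % 2 = 1 ∧ w % 2 = 1 ∧ (v - w = 2 ∨ w - v = 2)) ∨
  (v % 2 = 1 ∧ w % 2 = 0 ∧ (w - 2 * v = -12 ∨ w - 2 * v = -8 ∨ w - 2 * v = -4 ∨ w - 2 * v = 0 ∨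
    w - 2 * v = -2 ∨ w - 2 * v = 2)) ∨
  (v % 2 = 0 ∧ w % 2 = 1 ∧ (v - 2 * w = -12 ∨ v - 2 * w = -8 ∨ v - 2 * w = -4 ∨ v - 2 * w = 0 ∨
    v - 2 * w = -2 ∨ v - 2 * w = 2))

theorem codeAdj_code :
    (∀ i j, CodeAdj (2 * i) (2 * j) ↔ i - j ≠ 0 ∧ i - j ≤ 2 ∧ j - i ≤ 2) ∧
    (∀ m m', CodeAdj (2 * m + 1) (2 * m' + 1) ↔ m - m' = 1 ∨ m' - m = 1) ∧
    (∀ m i, CodeAdj (2 * m + 1) (2 * i) ↔ i - 2 * m = -5 ∨ i - 2 * m = -3 ∨ i - 2 * m = -1 ∨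
      i - 2 * m = 1 ∨ i - 2 * m = 0 ∨ i - 2 * m = 2) ∧
    (∀ i m, CodeAdj (2 * i) (2 * m + 1) ↔ i - 2 * m = -5 ∨ i - 2 * m = -3 ∨ i - 2 * m = -1 ∨
      i - 2 * m = 1 ∨ i - 2 * m = 0 ∨ i - 2 * m = 2) := by
  refine ⟨fun i j => ?_, fun m m' => ?_, fun m i => ?_, fun m i => ?_⟩ <;> unfold CodeAdj <;> omega

/-- A family of generators satisfying the relations of the extended FFD algebra for all integer
vertex codes, where the generators with non-positive code vanish. -/
structure GenSystem (g : ℤ → A) (σ : ℤ → ℂ) : Prop where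
  sq : ∀ v, g v * g v = σ v • (1 : A)
  anti : ∀ v w, CodeAdj v w → g v * g w = -(g w * g v)
  comm : ∀ v w, ¬CodeAdj v w → g v * g w = g w * g v
  low : ∀ v ≤ 0, g v = 0
  ac : ∀ m, (g (2 * (2 * m)) * g (2 * (2 * m - 3)) + g (2 * (2 * m - 2)) * g (2 * m + 1)) *
      (g (2 * (2 * m - 1)) * g (2 * (m + 2) + 1)) =
    g (2 * (2 * m - 3)) * g (2 * (m + 1) + 1) *
      (g (2 * (2 * m + 4)) * g (2 * (2 * m + 1)) + g (2 * (2 * m + 2)) * g (2 * (m + 2) + 1))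

/-- The sum of the generators of the `n`-th clique. -/
def cliqueSum {A : Type*} [Ring A] (g : ℤ → A) (n : ℤ) : A :=
  g (2 * (2 * n - 1)) + g (2 * (2 * n)) + g (2 * n + 1)

/-- The anticommutator of consecutive clique sums. -/
def cliqueA (g : ℤ → A) (n : ℤ) : A :=
  (2 : ℂ) • (g (2 * (2 * n)) * g (2 * (2 * n - 3)) + g (2 * (2 * n - 2)) * g (2 * n + 1))

/-- The commutator of the clique sums at distance two. -/
def cliqueC (g : ℤ → A) (n : ℤ) : A := (2 : ℂ) • (g (2 * (2 * n - 3)) * g (2 * (n + 1) + 1))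

section GenSystem

variable {g : ℤ → A} {σ : ℤ → ℂ}

theorem GenSystem.mul_comm (hg : GenSystem g σ) {v v' w : ℤ} (h : CodeAdj v w ↔ CodeAdj v' w) :
    g v * g v' * g w = g w * (g v * g v') := by
  by_cases h1 : CodeAdj v w
  · rw [mul_assoc, hg.anti _ _ (h.1 h1), mul_neg, ← mul_assoc, hg.anti _ _ h1]
    noncomm_ring
  · rw [mul_assoc, hg.comm _ _ (mt h.2 h1), ← mul_assoc, hg.comm _ _ h1, mul_assoc]

theorem GenSystem.mul_anti (hg : GenSystem g σ) {v v' w : ℤ}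
    (h : ¬(CodeAdj v w ↔ CodeAdj v' w)) : g v * g v' * g w = -(g w * (g v * g v')) := by
  by_cases h1 : CodeAdj v w
  · rw [mul_assoc, hg.comm _ _ fun h2 => h (iff_of_true h1 h2), ← mul_assoc, hg.anti _ _ h1]
    noncomm_ring
  · rw [mul_assoc, hg.anti _ _ (not_not.1 fun h2 => h (iff_of_false h1 h2)), mul_neg,
      ← mul_assoc, hg.comm _ _ h1, mul_assoc]

theorem GenSystem.cliqueA_comm (hg : GenSystem g σ) {n w : ℤ}
    (h : CodeAdj (2 * (2 * n)) w ↔ CodeAdj (2 * (2 * n - 3)) w)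
    (h' : CodeAdj (2 * (2 * n - 2)) w ↔ CodeAdj (2 * n + 1) w) :
    cliqueA g n * g w = g w * cliqueA g n := by
  rw [cliqueA, smul_mul_assoc, mul_smul_comm, add_mul, mul_add, hg.mul_comm h, hg.mul_comm h']

theorem GenSystem.cliqueA_anti (hg : GenSystem g σ) {n w : ℤ}
    (h : ¬(CodeAdj (2 * (2 * n)) w ↔ CodeAdj (2 * (2 * n - 3)) w))
    (h' : ¬(CodeAdj (2 * (2 * n - 2)) w ↔ CodeAdj (2 * n + 1) w)) :
    cliqueA g n * g w = -(g w * cliqueA g n) := by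
  rw [cliqueA, smul_mul_assoc, mul_smul_comm, add_mul, mul_add, hg.mul_anti h, hg.mul_anti h',
    ← neg_add, smul_neg]

theorem GenSystem.cliqueC_comm (hg : GenSystem g σ) {n w : ℤ}
    (h : CodeAdj (2 * (2 * n - 3)) w ↔ CodeAdj (2 * (n + 1) + 1) w) :
    cliqueC g n * g w = g w * cliqueC g n := by
  rw [cliqueC, smul_mul_assoc, mul_smul_comm, hg.mul_comm h]

theorem GenSystem.cliqueC_anti (hg : GenSystem g σ) {n w : ℤ}
    (h : ¬(CodeAdj (2 * (2 * n - 3)) w ↔ CodeAdj (2 * (n + 1) + 1) w)) :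
    cliqueC g n * g w = -(g w * cliqueC g n) := by
  rw [cliqueC, smul_mul_assoc, mul_smul_comm, hg.mul_anti h, smul_neg]

theorem comm_cliqueSum {A : Type*} [Ring A] {g : ℤ → A} {z : A} {n : ℤ}
    (h1 : z * g (2 * (2 * n - 1)) = g (2 * (2 * n - 1)) * z)
    (h2 : z * g (2 * (2 * n)) = g (2 * (2 * n)) * z) (h3 : z * g (2 * n + 1) = g (2 * n + 1) * z) :
    z * cliqueSum g n = cliqueSum g n * z := by
  rw [cliqueSum, mul_add, mul_add, add_mul, add_mul, h1, h2, h3]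

theorem anti_cliqueSum {A : Type*} [Ring A] {g : ℤ → A} {z : A} {n : ℤ}
    (h1 : z * g (2 * (2 * n - 1)) = -(g (2 * (2 * n - 1)) * z))
    (h2 : z * g (2 * (2 * n)) = -(g (2 * (2 * n)) * z)) (h3 : z * g (2 * n + 1) = -(g (2 * n + 1) * z)) :
    z * cliqueSum g n = -(cliqueSum g n * z) := by
  rw [cliqueSum, mul_add, mul_add, add_mul, add_mul, h1, h2, h3, neg_add, neg_add]

theorem GenSystem.cliqueChain (hg : GenSystem g σ) :
    CliqueChain (cliqueSum g) (cliqueA g) (cliqueC g)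
      (fun n => σ (2 * (2 * n - 1)) + σ (2 * (2 * n)) + σ (2 * n + 1)) where
  sq n := by
    have h1 := hg.anti (2 * (2 * n - 1)) (2 * (2 * n)) (by simp only [codeAdj_code]; omega)
    have h2 := hg.anti (2 * (2 * n - 1)) (2 * n + 1) (by simp only [codeAdj_code]; omega)
    have h3 := hg.anti (2 * (2 * n)) (2 * n + 1) (by simp only [codeAdj_code]; omega)
    simp only [cliqueSum, add_mul, mul_add, add_smul, hg.sq, h1, h2, h3]
    abel
  zero n hn := by
    simp [cliqueSum, hg.low (2 * (2 * n - 1)) (by omega), hg.low (2 * (2 * n)) (by omega),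
      hg.low (2 * n + 1) (by omega)]
  anticomm_S n := by
    have h1 := hg.anti (2 * (2 * n - 1)) (2 * (2 * (n - 1) - 1)) (by simp only [codeAdj_code]; omega)
    have h2 := hg.anti (2 * (2 * n - 1)) (2 * (2 * (n - 1))) (by simp only [codeAdj_code]; omega)
    have h3 := hg.anti (2 * (2 * n - 1)) (2 * (n - 1) + 1) (by simp only [codeAdj_code]; omega)
    have h4 := hg.comm (2 * (2 * n)) (2 * (2 * (n - 1) - 1)) (by simp only [codeAdj_code]; omega)
    have h5 := hg.anti (2 * (2 * n)) (2 * (2 * (n - 1))) (by simp only [codeAdj_code]; omega)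
    have h6 := hg.anti (2 * (2 * n)) (2 * (n - 1) + 1) (by simp only [codeAdj_code]; omega)
    have h7 := hg.anti (2 * n + 1) (2 * (2 * (n - 1) - 1)) (by simp only [codeAdj_code]; omega)
    have h8 := hg.comm (2 * n + 1) (2 * (2 * (n - 1))) (by simp only [codeAdj_code]; omega)
    have h9 := hg.anti (2 * n + 1) (2 * (n - 1) + 1) (by simp only [codeAdj_code]; omega)
    simp only [cliqueSum, cliqueA, add_mul, mul_add, h1, h2, h3, h4, h5, h6, h7, h8, h9,
      show 2 * n - 3 = 2 * (n - 1) - 1 by ring, show 2 * n - 2 = 2 * (n - 1) by ring, two_smul]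
    abel
  comm_S n := by
    have h1 := hg.comm (2 * (2 * n - 1)) (2 * (2 * (n - 2) - 1)) (by simp only [codeAdj_code]; omega)
    have h2 := hg.comm (2 * (2 * n - 1)) (2 * (2 * (n - 2))) (by simp only [codeAdj_code]; omega)
    have h3 := hg.comm (2 * (2 * n - 1)) (2 * (n - 2) + 1) (by simp only [codeAdj_code]; omega)
    have h4 := hg.comm (2 * (2 * n)) (2 * (2 * (n - 2) - 1)) (by simp only [codeAdj_code]; omega)
    have h5 := hg.comm (2 * (2 * n)) (2 * (2 * (n - 2))) (by simp only [codeAdj_code]; omega)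
    have h6 := hg.comm (2 * (2 * n)) (2 * (n - 2) + 1) (by simp only [codeAdj_code]; omega)
    have h7 := hg.anti (2 * n + 1) (2 * (2 * (n - 2) - 1)) (by simp only [codeAdj_code]; omega)
    have h8 := hg.comm (2 * n + 1) (2 * (2 * (n - 2))) (by simp only [codeAdj_code]; omega)
    have h9 := hg.comm (2 * n + 1) (2 * (n - 2) + 1) (by simp only [codeAdj_code]; omega)
    simp only [cliqueSum, cliqueC, add_mul, mul_add, h1, h2, h3, h4, h5, h6, h7, h8, h9,
      show 2 * (n - 1) - 3 = 2 * (n - 2) - 1 by ring, show n - 1 + 1 = n by ring,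
      two_smul]
    abel
  S_far n k hk := by
    refine comm_cliqueSum ?_ ?_ ?_ <;> symm <;> refine comm_cliqueSum ?_ ?_ ?_ <;>
      exact hg.comm _ _ (by simp only [codeAdj_code]; omega)
  a_S n := by
    refine anti_cliqueSum ?_ ?_ ?_ <;>
      exact hg.cliqueA_anti (by simp only [codeAdj_code]; omega) (by simp only [codeAdj_code]; omega)
  S_a n := by
    rw [eq_neg_iff_add_eq_zero, add_comm, ← eq_neg_iff_add_eq_zero]
    refine anti_cliqueSum ?_ ?_ ?_ <;>
      exact hg.cliqueA_anti (by simp only [codeAdj_code]; omega) (by simp only [codeAdj_code]; omega)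
  a_far n k hk := by
    refine comm_cliqueSum ?_ ?_ ?_ <;>
      exact hg.cliqueA_comm (by simp only [codeAdj_code]; omega) (by simp only [codeAdj_code]; omega)
  c_S n := by
    refine comm_cliqueSum ?_ ?_ ?_ <;> exact hg.cliqueC_comm (by simp only [codeAdj_code]; omega)
  c_S_one n := by
    refine anti_cliqueSum ?_ ?_ ?_ <;> exact hg.cliqueC_anti (by simp only [codeAdj_code]; omega)
  c_S_two n := by
    refine anti_cliqueSum ?_ ?_ ?_ <;> exact hg.cliqueC_anti (by simp only [codeAdj_code]; omega)
  S_c n := by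
    rw [eq_neg_iff_add_eq_zero, add_comm, ← eq_neg_iff_add_eq_zero]
    refine anti_cliqueSum ?_ ?_ ?_ <;> exact hg.cliqueC_anti (by simp only [codeAdj_code]; omega)
  c_far n k hk := by
    refine comm_cliqueSum ?_ ?_ ?_ <;> exact hg.cliqueC_comm (by simp only [codeAdj_code]; omega)
  ac n := by
    have h := hg.ac (n - 2)
    have h1 : Commute (cliqueA g (n - 2)) (cliqueC g (n - 1)) := by
      refine (Commute.mul_right ?_ ?_).smul_right _ <;>
        exact hg.cliqueA_comm (by simp only [codeAdj_code]; omega) (by simp only [codeAdj_code]; omega)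
    have h2 : Commute (cliqueA g n) (cliqueC g (n - 2)) := by
      refine (Commute.mul_right ?_ ?_).smul_right _ <;>
        exact hg.cliqueA_comm (by simp only [codeAdj_code]; omega) (by simp only [codeAdj_code]; omega)
    rw [h2.eq, ← h1.eq]
    simp only [show n - 2 + 2 = n by ring, show 2 * (n - 2) + 4 = 2 * n by ring,
      show 2 * (2 * (n - 2) + 1) = 2 * (2 * n - 3) by ring, show 2 * (n - 2) + 2 = 2 * n - 2 by ring] at h
    simp only [cliqueA, cliqueC, smul_mul_smul_comm, show n - 1 + 1 = n by ring,
      show 2 * (n - 1) - 3 = 2 * (n - 2) - 1 by ring]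
    rw [h]

end GenSystem

section Independent

variable {g : ℕ → A} {adj : ℕ → ℕ → Prop} {v : ℕ} {V W S : Finset ℕ} {w : ℂ}

/-- The product of the generators of a set of codes, in increasing order. -/
def sortProd {R : Type*} [Monoid R] (g : ℕ → R) (S : Finset ℕ) : R :=
  ((S.sort (· ≤ ·)).map g).prod

/-- No two distinct elements of `S` are adjacent. -/
def Indep (adj : ℕ → ℕ → Prop) (S : Finset ℕ) : Prop := ∀ a ∈ S, ∀ b ∈ S, a ≠ b → ¬adj a b

open scoped Classical in
/-- The generating function of the independent subsets of `V`. -/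
noncomputable def indepSum (adj : ℕ → ℕ → Prop) (g : ℕ → A) (w : ℂ) (V : Finset ℕ) : A :=
  ∑ S ∈ V.powerset with Indep adj S, w ^ S.card • sortProd g S

theorem sortProd_insert {R : Type*} [Monoid R] {g : ℕ → R} {v : ℕ} {S : Finset ℕ} (hv : v ∉ S)
    (h : ∀ a ∈ insert v S, ∀ b ∈ insert v S, Commute (g a) (g b)) :
    sortProd g (insert v S) = g v * sortProd g S := by
  rw [sortProd, sortProd, ← List.prod_cons, ← List.map_cons]
  refine List.Perm.prod_eq' (List.Perm.map g ?_) ?_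
  · refine (List.perm_ext_iff_of_nodup (Finset.sort_nodup _ _) ?_).2 fun a => ?_
    · simp [hv, Finset.sort_nodup]
    · simp
  · rw [List.pairwise_map]
    exact List.Pairwise.imp_of_mem (R := fun _ _ => True)
      (fun ha hb _ => h _ ((Finset.mem_sort _).1 ha) _ ((Finset.mem_sort _).1 hb))
      (List.pairwise_of_forall fun _ _ => trivial)

theorem sortProd_comm {R : Type*} [Monoid R] {g : ℕ → R} {S : Finset ℕ} {z : R}
    (h : ∀ a ∈ S, Commute z (g a)) : Commute z (sortProd g S) := by
  refine Commute.list_prod_right _ _ fun y hy => ?_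
  obtain ⟨a, ha, rfl⟩ := List.mem_map.1 hy
  exact h a ((Finset.mem_sort _).1 ha)

/-- Conjugating a product of pairwise commuting generators by a generator anticommuting with at
most one of them. -/
theorem sortProd_anti {A : Type*} [Ring A] {g : ℕ → A}
    (hanti : ∀ a b, adj a b → g a * g b = -(g b * g a))
    (hcomm : ∀ a b, ¬adj a b → g a * g b = g b * g a) (hS : Indep adj S)
    (hv : ∀ a ∈ S, ∀ b ∈ S, adj v a → adj v b → a ≠ b → adj a b) {y : ℕ} (hy : y ∈ S)
    (hvy : adj v y) : g v * sortProd g S = -(sortProd g S * g v) := by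
  have hc : ∀ a ∈ S, ∀ b ∈ S, Commute (g a) (g b) := fun a ha b hb => by
    rcases eq_or_ne a b with rfl | hab
    · exact Commute.refl _
    · exact hcomm _ _ (hS a ha b hb hab)
  have h1 : sortProd g S = g y * sortProd g (S.erase y) := by
    conv_lhs => rw [← Finset.insert_erase hy]
    exact sortProd_insert (by simp) (by simpa only [Finset.insert_erase hy] using hc)
  have h2 : Commute (g v) (sortProd g (S.erase y)) := sortProd_comm fun a ha => by
    obtain ⟨hay, ha⟩ := Finset.mem_erase.1 ha
    exact hcomm _ _ fun hva => hS a ha y hy hay (hv a ha y hy hva hvy hay)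
  rw [h1, ← mul_assoc, hanti _ _ hvy, neg_mul, mul_assoc, h2.eq, mul_assoc]

open scoped Classical in
theorem indepSum_insert (hsymm : ∀ a b, adj a b → adj b a)
    (hcomm : ∀ a b, ¬adj a b → g a * g b = g b * g a) (hv : v ∉ W) :
    indepSum adj g w (insert v W) =
      indepSum adj g w W + w • (g v * indepSum adj g w {a ∈ W | ¬adj v a}) := by
  simp only [indepSum, Finset.sum_filter]
  rw [Finset.sum_powerset_insert hv]
  congr 1
  rw [← Finset.sum_subset (Finset.powerset_mono.2 (Finset.filter_subset (fun a => ¬adj v a) W)),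
    Finset.mul_sum, Finset.smul_sum]
  · refine Finset.sum_congr rfl fun S hS => ?_
    rw [Finset.mem_powerset] at hS
    have hvS : v ∉ S := fun h => hv (Finset.mem_filter.1 (hS h)).1
    have hna : ∀ a ∈ S, ¬adj v a := fun a ha => (Finset.mem_filter.1 (hS ha)).2
    have hiff : Indep adj (insert v S) ↔ Indep adj S := by
      refine ⟨fun h a ha b hb => h a (by simp [ha]) b (by simp [hb]), fun h a ha b hb hab => ?_⟩
      rcases Finset.mem_insert.1 ha with rfl | ha' <;> rcases Finset.mem_insert.1 hb with rfl | hb'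
      · exact absurd rfl hab
      · exact hna b hb'
      · exact fun h' => hna a ha' (hsymm _ _ h')
      · exact h a ha' b hb' hab
    by_cases hind : Indep adj S
    · rw [if_pos (hiff.2 hind), if_pos hind, Finset.card_insert_of_notMem hvS,
        sortProd_insert hvS fun a ha b hb => ?_, pow_succ', mul_smul_comm, smul_smul]
      rcases eq_or_ne a b with rfl | hab
      · exact Commute.refl _
      · exact hcomm _ _ (hiff.2 hind a ha b hb hab)
    · rw [if_neg (mt hiff.1 hind), if_neg hind, mul_zero, smul_zero]
  · intro S hS hS'
    rw [Finset.mem_powerset] at hS hS'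
    rw [if_neg]
    intro hind
    refine hS' fun a ha => Finset.mem_filter.2 ⟨hS ha, ?_⟩
    exact hind v (by simp) a (by simp [ha]) fun h => hv (h ▸ hS ha)

open scoped Classical in
theorem indepSum_anticomm (hanti : ∀ a b, adj a b → g a * g b = -(g b * g a))
    (hcomm : ∀ a b, ¬adj a b → g a * g b = g b * g a)
    (hv : ∀ a ∈ V, ∀ b ∈ V, adj v a → adj v b → a ≠ b → adj a b) :
    g v * indepSum adj g w V + indepSum adj g w V * g v =
      (2 : ℂ) • (g v * indepSum adj g w {a ∈ V | ¬adj v a}) := by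
  have hsub : {S ∈ ({a ∈ V | ¬adj v a} : Finset ℕ).powerset | Indep adj S} ⊆
      {S ∈ V.powerset | Indep adj S} :=
    Finset.filter_subset_filter _ (Finset.powerset_mono.2 (Finset.filter_subset _ V))
  have h1 : g v * indepSum adj g w {a ∈ V | ¬adj v a} =
      indepSum adj g w {a ∈ V | ¬adj v a} * g v := by
    rw [indepSum, Finset.mul_sum, Finset.sum_mul]
    refine Finset.sum_congr rfl fun S hS => ?_
    rw [Finset.mem_filter, Finset.mem_powerset] at hS
    rw [mul_smul_comm, smul_mul_assoc, (sortProd_comm fun a ha => ?_ : Commute _ _).eq]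
    exact hcomm _ _ (Finset.mem_filter.1 (hS.1 ha)).2
  have h2 : indepSum adj g w V =
      ∑ S ∈ {S ∈ V.powerset | Indep adj S} \
        {S ∈ ({a ∈ V | ¬adj v a} : Finset ℕ).powerset | Indep adj S}, w ^ S.card • sortProd g S
      + indepSum adj g w {a ∈ V | ¬adj v a} := (Finset.sum_sdiff hsub).symm
  have h3 : g v * ∑ S ∈ {S ∈ V.powerset | Indep adj S} \
        {S ∈ ({a ∈ V | ¬adj v a} : Finset ℕ).powerset | Indep adj S}, w ^ S.card • sortProd g S =
      -((∑ S ∈ {S ∈ V.powerset | Indep adj S} \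
        {S ∈ ({a ∈ V | ¬adj v a} : Finset ℕ).powerset | Indep adj S}, w ^ S.card • sortProd g S)
        * g v) := by
    rw [Finset.mul_sum, Finset.sum_mul, ← Finset.sum_neg_distrib]
    refine Finset.sum_congr rfl fun S hS => ?_
    simp only [Finset.mem_sdiff, Finset.mem_filter, Finset.mem_powerset, not_and] at hS
    obtain ⟨⟨hSV, hind⟩, hS⟩ := hS
    obtain ⟨y, hy, hy'⟩ := Finset.not_subset.1 fun h => hS h hind
    have hvy : adj v y := by
      by_contra h
      exact hy' (Finset.mem_filter.2 ⟨hSV hy, h⟩)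
    rw [mul_smul_comm, smul_mul_assoc, sortProd_anti hanti hcomm hind
      (fun a ha b hb => hv a (hSV ha) b (hSV hb)) hy hvy, smul_neg]
  rw [h2, mul_add, add_mul, h3, h1, two_smul]
  abel

open scoped Classical in
theorem indepSum_insert_clique (hsymm : ∀ a b, adj a b → adj b a)
    (hanti : ∀ a b, adj a b → g a * g b = -(g b * g a))
    (hcomm : ∀ a b, ¬adj a b → g a * g b = g b * g a) (hvW : v ∉ W)
    (hVW : ∀ a, ¬adj v a → (a ∈ W ↔ a ∈ V))
    (hv : ∀ a ∈ V, ∀ b ∈ V, adj v a → adj v b → a ≠ b → adj a b) :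
    indepSum adj g w (insert v W) = indepSum adj g w W
      + (w / 2) • (g v * indepSum adj g w V + indepSum adj g w V * g v) := by
  have h : ({a ∈ W | ¬adj v a} : Finset ℕ) = {a ∈ V | ¬adj v a} := by
    ext a
    simp only [Finset.mem_filter]
    exact ⟨fun h => ⟨(hVW a h.2).1 h.1, h.2⟩, fun h => ⟨(hVW a h.2).2 h.1, h.2⟩⟩
  rw [indepSum_insert hsymm hcomm hvW, indepSum_anticomm hanti hcomm hv, h, smul_smul]
  congr 2
  ring

theorem indepSum_empty : indepSum adj g w ∅ = 1 := by
  classical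
  rw [indepSum, Finset.powerset_empty, Finset.filter_singleton, if_pos (by simp [Indep])]
  simp [sortProd]

end Independent

section Transfer

variable {g : ℤ → A} {σ : ℤ → ℂ} {w : ℂ}

/-- The vertex codes belonging to the first `k` cliques. -/
def cliqueVertices (k : ℕ) : Finset ℕ :=
  {c ∈ Finset.range (4 * k) | (c % 2 = 0 ∧ 2 ≤ c ∧ c + 4 ≤ 4 * k) ∨ (c % 2 = 1 ∧ c + 1 ≤ 2 * k)}

theorem mem_cliqueVertices {k c : ℕ} : c ∈ cliqueVertices k ↔
    (c % 2 = 0 ∧ 2 ≤ c ∧ c + 4 ≤ 4 * k) ∨ (c % 2 = 1 ∧ c + 1 ≤ 2 * k) := by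
  rw [cliqueVertices, Finset.mem_filter, Finset.mem_range]
  omega

theorem cliqueVertices_succ {k : ℕ} (hk : 1 ≤ k) : cliqueVertices (k + 1) =
    insert (2 * k + 1) (insert (4 * k) (insert (4 * k - 2) (cliqueVertices k))) := by
  ext c
  simp only [Finset.mem_insert, mem_cliqueVertices]
  omega

theorem codeAdj_symm {v w : ℤ} (h : CodeAdj v w) : CodeAdj w v := by
  rcases h with ⟨h1, h2, h3, h4, h5⟩ | ⟨h1, h2, h3⟩ | ⟨h1, h2, h3⟩ | ⟨h1, h2, h3⟩
  · exact Or.inl ⟨h2, h1, h3.symm, h5, h4⟩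
  · exact Or.inr (Or.inl ⟨h2, h1, h3.symm⟩)
  · exact Or.inr (Or.inr (Or.inr ⟨h2, h1, h3⟩))
  · exact Or.inr (Or.inr (Or.inl ⟨h2, h1, h3⟩))

/-- The generating function of the independent sets of the first cliques. -/
noncomputable def transfer (g : ℤ → A) (w : ℂ) (n : ℤ) : A :=
  indepSum (fun a b => CodeAdj a b) (fun a => g a) w (cliqueVertices (n + 1).toNat)

theorem codeAdj_clique {k : ℕ} (hk : 1 ≤ k) {v : ℕ}
    (hv : v = 4 * k - 2 ∨ v = 4 * k ∨ v = 2 * k + 1) :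
    ∀ a ∈ cliqueVertices k, ∀ b ∈ cliqueVertices k, CodeAdj v a → CodeAdj v b → a ≠ b →
      CodeAdj a b := by
  intro a ha b hb h1 h2 hab
  rw [mem_cliqueVertices] at ha hb
  obtain ⟨j, rfl⟩ : ∃ j, k = j + 1 := ⟨k - 1, by omega⟩
  rcases hv with rfl | rfl | rfl
  · rw [show ((4 * (j + 1) - 2 : ℕ) : ℤ) = 2 * (2 * j + 1) by omega] at h1 h2
    rcases Nat.even_or_odd' a with ⟨a, rfl | rfl⟩ <;> rcases Nat.even_or_odd' b with ⟨b, rfl | rfl⟩ <;>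
      push_cast at h1 h2 ⊢ <;> simp only [codeAdj_code] at h1 h2 ⊢ <;> omega
  · rw [show ((4 * (j + 1) : ℕ) : ℤ) = 2 * (2 * j + 2) by omega] at h1 h2
    rcases Nat.even_or_odd' a with ⟨a, rfl | rfl⟩ <;> rcases Nat.even_or_odd' b with ⟨b, rfl | rfl⟩ <;>
      push_cast at h1 h2 ⊢ <;> simp only [codeAdj_code] at h1 h2 ⊢ <;> omega
  · rw [show ((2 * (j + 1) + 1 : ℕ) : ℤ) = 2 * (j + 1) + 1 by omega] at h1 h2
    rcases Nat.even_or_odd' a with ⟨a, rfl | rfl⟩ <;> rcases Nat.even_or_odd' b with ⟨b, rfl | rfl⟩ <;>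
      push_cast at h1 h2 ⊢ <;> simp only [codeAdj_code] at h1 h2 ⊢ <;> omega

theorem GenSystem.transfer_step (hg : GenSystem g σ) {k : ℕ} (hk : 1 ≤ k) :
    transfer g w k = transfer g w (k - 1) + (w / 2) •
      (cliqueSum g k * transfer g w (k - 1) + transfer g w (k - 1) * cliqueSum g k) := by
  have hsymm : ∀ a b : ℕ, CodeAdj a b → CodeAdj b a := fun a b => codeAdj_symm
  have hanti : ∀ a b : ℕ, CodeAdj a b → g a * g b = -(g b * g a) := fun a b => hg.anti a b
  have hcomm : ∀ a b : ℕ, ¬CodeAdj a b → g a * g b = g b * g a := fun a b => hg.comm a b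
  have h1 := indepSum_insert_clique (w := w) (v := 4 * k - 2) hsymm hanti hcomm
    (W := cliqueVertices k) (V := cliqueVertices k)
    (by rw [mem_cliqueVertices]; omega) (fun a _ => Iff.rfl) (codeAdj_clique hk (by simp))
  have h2 := indepSum_insert_clique (w := w) (v := 4 * k) hsymm hanti hcomm
    (W := insert (4 * k - 2) (cliqueVertices k)) (V := cliqueVertices k)
    (by rw [Finset.mem_insert, mem_cliqueVertices]; omega)
    (fun a ha => by rw [Finset.mem_insert, or_iff_right]; rintro rfl; unfold CodeAdj at ha; omega)
    (codeAdj_clique hk (by simp))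
  have h3 := indepSum_insert_clique (w := w) (v := 2 * k + 1) hsymm hanti hcomm
    (W := insert (4 * k) (insert (4 * k - 2) (cliqueVertices k))) (V := cliqueVertices k)
    (by rw [Finset.mem_insert, Finset.mem_insert, mem_cliqueVertices]; omega)
    (fun a ha => by
      rw [Finset.mem_insert, Finset.mem_insert, or_iff_right, or_iff_right] <;> rintro rfl <;>
        unfold CodeAdj at ha <;> omega)
    (codeAdj_clique hk (by simp))
  rw [h2, h1] at h3
  rw [transfer, transfer, show ((k : ℤ) + 1).toNat = k + 1 by omega,
    show ((k : ℤ) - 1 + 1).toNat = k by omega, cliqueVertices_succ hk, h3, cliqueSum,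
    show ((4 * k - 2 : ℕ) : ℤ) = 2 * (2 * k - 1) by omega,
    show ((4 * k : ℕ) : ℤ) = 2 * (2 * k) by omega,
    show ((2 * k + 1 : ℕ) : ℤ) = 2 * k + 1 by omega]
  simp only [mul_add, add_mul]
  module

theorem GenSystem.isTransfer (hg : GenSystem g σ) (u : ℂ) :
    IsTransfer (cliqueSum g) u (transfer g (-(2 * u))) where
  low n hn := by
    rw [transfer, show (n + 1).toNat = 0 by omega]
    exact indepSum_empty
  step n := by
    rcases lt_trichotomy n 0 with hn | rfl | hn
    · rw [hg.cliqueChain.zero n hn, transfer, transfer, show (n + 1).toNat = 0 by omega,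
        show (n - 1 + 1).toNat = 0 by omega]
      simp
    · have h := indepSum_insert_clique (w := -(2 * u)) (v := 1) (W := ∅) (V := ∅)
        (adj := fun a b => CodeAdj a b) (g := fun a : ℕ => g a) (fun a b => codeAdj_symm)
        (fun a b => hg.anti a b) (fun a b => hg.comm a b) (by simp) (by simp) (by simp)
      have h1 : cliqueVertices (0 + 1 : ℤ).toNat = insert 1 ∅ := by
        ext c
        rw [mem_cliqueVertices]
        simp
        omega
      rw [transfer, transfer, h1, h, indepSum_empty, cliqueSum, hg.low (2 * (2 * 0 - 1)) (by norm_num),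
        hg.low (2 * (2 * 0)) (by norm_num)]
      rw [show cliqueVertices (0 - 1 + 1 : ℤ).toNat = ∅ from rfl, indepSum_empty]
      simp only [zero_add, Nat.cast_one, mul_zero]
      module
    · obtain ⟨k, rfl⟩ := Int.eq_ofNat_of_zero_le hn.le
      rw [hg.transfer_step (by omega)]
      module

theorem GenSystem.transfer_comm (hg : GenSystem g σ) {w z : ℂ} (h : w + z ≠ 0) (n : ℤ) :
    transfer g w n * transfer g z n = transfer g z n * transfer g w n := by
  have := IsTransfer.commute (u := -w / 2) (v := -z / 2) hg.cliqueChain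
    (fun h' => h (by linear_combination -2 * h')) (hg.isTransfer _) (hg.isTransfer _) n
  ring_nf at this
  exact this

end Transfer

section Coefficients

theorem eq_zero_of_forall_sum_pow_smul {E : Type*} [AddCommGroup E] [Module ℂ E] {N : ℕ}
    {c : ℕ → E} (h : ∀ m : ℕ, ∑ k ∈ Finset.range N, ((m : ℂ) + 1) ^ k • c k = 0) {k : ℕ}
    (hk : k < N) : c k = 0 := by
  refine (Module.forall_dual_apply_eq_zero_iff ℂ _).1 fun φ => ?_
  let p : Polynomial ℂ := ∑ k ∈ Finset.range N, Polynomial.monomial k (φ (c k))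
  have hp : p = 0 := by
    refine Polynomial.eq_zero_of_infinite_isRoot p
      ((Set.infinite_range_of_injective (f := fun m : ℕ => (m : ℂ) + 1) ?_).mono ?_)
    · intro m m' hm
      simpa using hm
    · rintro _ ⟨m, rfl⟩
      have h' := congrArg φ (h m)
      simp only [map_sum, map_smul, map_zero, smul_eq_mul] at h'
      simp only [p, Set.mem_ofPred_eq, Polynomial.IsRoot, Polynomial.eval_finsetSum,
        Polynomial.eval_monomial]
      simpa only [mul_comm] using h'
  have h' := congrArg (fun q => Polynomial.coeff q k) hp
  simpa [p, Polynomial.finsetSum_coeff, Polynomial.coeff_monomial, hk] using h'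

theorem commute_of_forall_sum_pow_smul {N : ℕ} {c : ℕ → A}
    (h : ∀ w z : ℂ, w + z ≠ 0 → Commute (∑ k ∈ Finset.range N, w ^ k • c k)
      (∑ k ∈ Finset.range N, z ^ k • c k)) {k l : ℕ} (hk : k < N) (hl : l < N) :
    Commute (c k) (c l) := by
  refine sub_eq_zero.1 (eq_zero_of_forall_sum_pow_smul (c := fun l => c k * c l - c l * c k)
    (fun m => ?_) hl)
  refine eq_zero_of_forall_sum_pow_smul (c := fun k => ∑ l ∈ Finset.range N,
    ((m : ℂ) + 1) ^ l • (c k * c l - c l * c k)) (fun n => ?_) hk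
  have h0 : ((n : ℂ) + 1) + (m + 1) ≠ 0 := by
    exact_mod_cast (by omega : n + 1 + (m + 1) ≠ 0)
  rw [← sub_eq_zero.2 (h _ _ h0).eq, Finset.sum_mul_sum, Finset.sum_mul_sum,
    Finset.sum_comm (f := fun i j => ((m : ℂ) + 1) ^ i • c i * ((n : ℂ) + 1) ^ j • c j),
    ← Finset.sum_sub_distrib]
  refine Finset.sum_congr rfl fun i _ => ?_
  rw [Finset.smul_sum, ← Finset.sum_sub_distrib]
  refine Finset.sum_congr rfl fun j _ => ?_
  simp only [smul_mul_smul_comm, smul_sub, smul_smul]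
  rw [mul_comm (((m : ℂ) + 1) ^ j)]

end Coefficients

section Extension

variable {M : ℤ} {h hb : ℤ → A} {b bb : ℤ → ℂ}

/-- The integer codes of the vertices of the frustration graph. -/
def IsCode (M v : ℤ) : Prop :=
  (v % 2 = 0 ∧ 2 ≤ v ∧ v ≤ 2 * M) ∨ (v % 2 = 1 ∧ 1 ≤ v ∧ v ≤ 2 * (M / 2) + 1)

open scoped Classical in
/-- The generator of a vertex code, extended by zero to all integers. -/
noncomputable def extGen (M : ℤ) (h hb : ℤ → A) (v : ℤ) : A :=
  if IsCode M v then if v % 2 = 0 then h (v / 2) else hb (v / 2) else 0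

theorem extGen_of_not_isCode {A : Type*} [Ring A] {M : ℤ} {h hb : ℤ → A} {v : ℤ}
    (hv : ¬IsCode M v) : extGen M h hb v = 0 := if_neg hv

theorem extGen_even {A : Type*} [Ring A] {M : ℤ} {h hb : ℤ → A} {i : ℤ} (h1 : 1 ≤ i)
    (h2 : i ≤ M) : extGen M h hb (2 * i) = h i := by
  rw [extGen, if_pos (by unfold IsCode; omega), if_pos (by omega)]
  congr 1
  omega

theorem extGen_odd {A : Type*} [Ring A] {M : ℤ} {h hb : ℤ → A} {m : ℤ} (h1 : 0 ≤ m)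
    (h2 : m ≤ M / 2) : extGen M h hb (2 * m + 1) = hb m := by
  rw [extGen, if_pos (by unfold IsCode; omega), if_neg (by omega)]
  congr 1
  omega

theorem exists_of_isCode {v : ℤ} (hv : IsCode M v) :
    (∃ i, 1 ≤ i ∧ i ≤ M ∧ v = 2 * i) ∨ ∃ m, 0 ≤ m ∧ m ≤ M / 2 ∧ v = 2 * m + 1 := by
  rcases hv with ⟨h1, h2, h3⟩ | ⟨h1, h2, h3⟩
  · exact Or.inl ⟨v / 2, by omega, by omega, by omega⟩
  · exact Or.inr ⟨v / 2, by omega, by omega, by omega⟩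

theorem FFDHyp.extGen_sq (hyp : FFDHyp M h hb b bb) (v : ℤ) :
    ∃ s : ℂ, extGen M h hb v * extGen M h hb v = s • (1 : A) := by
  by_cases hv : IsCode M v
  · rcases exists_of_isCode hv with ⟨i, h1, h2, rfl⟩ | ⟨i, h1, h2, rfl⟩
    · exact ⟨_, by rw [extGen_even h1 h2, hyp.hsq i h1 h2]⟩
    · exact ⟨_, by rw [extGen_odd h1 h2, hyp.hbsq i h1 h2]⟩
  · exact ⟨0, by rw [extGen_of_not_isCode hv, mul_zero, zero_smul]⟩

theorem codeAdj_odd_even {m i : ℤ} : CodeAdj (2 * m + 1) (2 * i) ↔ MixedRel m i := by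
  rw [codeAdj_code.2.2.1, MixedRel]
  omega

theorem codeAdj_even_odd {m i : ℤ} : CodeAdj (2 * i) (2 * m + 1) ↔ MixedRel m i := by
  rw [codeAdj_code.2.2.2, MixedRel]
  omega

theorem codeAdj_even_even {i j : ℤ} :
    CodeAdj (2 * i) (2 * j) ↔ 1 ≤ |i - j| ∧ |i - j| ≤ 2 := by
  rw [codeAdj_code.1]
  rcases abs_cases (i - j) with h | h <;> omega

theorem codeAdj_odd_odd {m m' : ℤ} : CodeAdj (2 * m + 1) (2 * m' + 1) ↔ |m - m'| = 1 := by
  rw [codeAdj_code.2.1]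
  rcases abs_cases (m - m') with h | h <;> omega

theorem FFDHyp.extGen_anti (hyp : FFDHyp M h hb b bb) {v w : ℤ} (hvw : CodeAdj v w) :
    extGen M h hb v * extGen M h hb w = -(extGen M h hb w * extGen M h hb v) := by
  by_cases hv : IsCode M v; swap
  · simp [extGen_of_not_isCode hv]
  by_cases hw : IsCode M w; swap
  · simp [extGen_of_not_isCode hw]
  rcases exists_of_isCode hv with ⟨i, h1, h2, rfl⟩ | ⟨i, h1, h2, rfl⟩ <;>
    rcases exists_of_isCode hw with ⟨j, h3, h4, rfl⟩ | ⟨j, h3, h4, rfl⟩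
  · rw [codeAdj_even_even] at hvw
    rw [extGen_even h1 h2, extGen_even h3 h4, hyp.hanti i j h1 h2 h3 h4 hvw.1 hvw.2]
  · rw [codeAdj_even_odd] at hvw
    rw [extGen_even h1 h2, extGen_odd h3 h4, hyp.hbanti j i h3 h4 h1 h2 hvw, neg_neg]
  · rw [codeAdj_odd_even] at hvw
    rw [extGen_odd h1 h2, extGen_even h3 h4, hyp.hbanti i j h1 h2 h3 h4 hvw]
  · rw [codeAdj_odd_odd] at hvw
    rw [extGen_odd h1 h2, extGen_odd h3 h4, hyp.hbbanti i j h1 h2 h3 h4 hvw]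

theorem FFDHyp.extGen_comm (hyp : FFDHyp M h hb b bb) {v w : ℤ} (hvw : ¬CodeAdj v w) :
    extGen M h hb v * extGen M h hb w = extGen M h hb w * extGen M h hb v := by
  by_cases hv : IsCode M v; swap
  · simp [extGen_of_not_isCode hv]
  by_cases hw : IsCode M w; swap
  · simp [extGen_of_not_isCode hw]
  rcases exists_of_isCode hv with ⟨i, h1, h2, rfl⟩ | ⟨i, h1, h2, rfl⟩ <;>
    rcases exists_of_isCode hw with ⟨j, h3, h4, rfl⟩ | ⟨j, h3, h4, rfl⟩
  · rw [codeAdj_even_even] at hvw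
    rcases eq_or_ne i j with rfl | hij
    · rfl
    · have := Int.one_le_abs (sub_ne_zero.2 hij)
      rw [extGen_even h1 h2, extGen_even h3 h4, hyp.hcomm i j h1 h2 h3 h4 (by omega)]
  · rw [codeAdj_even_odd] at hvw
    rw [extGen_even h1 h2, extGen_odd h3 h4, hyp.hbcomm j i h3 h4 h1 h2 hvw]
  · rw [codeAdj_odd_even] at hvw
    rw [extGen_odd h1 h2, extGen_even h3 h4, hyp.hbcomm i j h1 h2 h3 h4 hvw]
  · rw [codeAdj_odd_odd] at hvw
    rcases eq_or_ne i j with rfl | hij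
    · rfl
    · rw [extGen_odd h1 h2, extGen_odd h3 h4, hyp.hbbcomm i j h1 h2 h3 h4 hij hvw]

theorem extGen_ac {A : Type*} [Ring A] {M : ℤ} {h hb : ℤ → A} (hac : ACRel M h hb) (m : ℤ) :
    (extGen M h hb (2 * (2 * m)) * extGen M h hb (2 * (2 * m - 3))
        + extGen M h hb (2 * (2 * m - 2)) * extGen M h hb (2 * m + 1)) *
      (extGen M h hb (2 * (2 * m - 1)) * extGen M h hb (2 * (m + 2) + 1)) =
    extGen M h hb (2 * (2 * m - 3)) * extGen M h hb (2 * (m + 1) + 1) *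
      (extGen M h hb (2 * (2 * m + 4)) * extGen M h hb (2 * (2 * m + 1))
        + extGen M h hb (2 * (2 * m + 2)) * extGen M h hb (2 * (m + 2) + 1)) := by
  rcases le_or_gt m 1 with hm | hm
  · rw [extGen_of_not_isCode (v := 2 * (2 * m - 3)) (by unfold IsCode; omega),
      extGen_of_not_isCode (v := 2 * (2 * m - 2)) (by unfold IsCode; omega)]
    simp
  rcases le_or_gt (M / 2 - 1) m with hm' | hm'
  · rw [extGen_of_not_isCode (v := 2 * (m + 2) + 1) (by unfold IsCode; omega),
      extGen_of_not_isCode (v := 2 * (2 * m + 4)) (by unfold IsCode; omega)]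
    simp
  · rw [extGen_even (i := 2 * m) (by omega) (by omega),
      extGen_even (i := 2 * m - 3) (by omega) (by omega),
      extGen_even (i := 2 * m - 2) (by omega) (by omega),
      extGen_even (i := 2 * m - 1) (by omega) (by omega),
      extGen_even (i := 2 * m + 4) (by omega) (by omega),
      extGen_even (i := 2 * m + 1) (by omega) (by omega),
      extGen_even (i := 2 * m + 2) (by omega) (by omega),
      extGen_odd (m := m) (by omega) (by omega),
      extGen_odd (m := m + 1) (by omega) (by omega),
      extGen_odd (m := m + 2) (by omega) (by omega)]
    have := hac m hm hm'
    simp only [AOp, COp, show 2 * (m + 1) - 3 = 2 * m - 1 by ring,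
      show m + 1 + 1 = m + 2 by ring, show 2 * (m + 2) = 2 * m + 4 by ring,
      show 2 * m + 4 - 3 = 2 * m + 1 by ring, show 2 * m + 4 - 2 = 2 * m + 2 by ring] at this
    exact this

theorem FFDHyp.exists_genSystem (hyp : FFDHyp M h hb b bb) (hac : ACRel M h hb) :
    ∃ σ, GenSystem (extGen M h hb) σ := by
  choose σ hσ using hyp.extGen_sq
  exact ⟨σ, hσ, fun _ _ => hyp.extGen_anti, fun _ _ => hyp.extGen_comm,
    fun v hv => extGen_of_not_isCode (by unfold IsCode; omega), extGen_ac hac⟩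

theorem extGen_eq_gen {A : Type*} [Ring A] {M : ℤ} {h hb : ℤ → A} {v : ℕ}
    (hv : IsCode M v) : extGen M h hb v = gen h hb v := by
  rw [extGen, if_pos hv, gen]
  norm_cast

theorem memG_iff_isCode (hM : 0 ≤ M) {v : ℕ} : memG M.toNat v ↔ IsCode M v := by
  unfold memG IsCode
  split_ifs <;> omega

theorem codeAdj_iff_adj {v w : ℕ} : CodeAdj v w ↔ Adj v w := by
  have h0 (a : ℕ) : 2 * a % 2 = 0 ∧ (2 * a + 1) % 2 ≠ 0 ∧ 2 * a / 2 = a ∧ (2 * a + 1) / 2 = a := by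
    omega
  unfold Adj
  rcases Nat.even_or_odd' v with ⟨v, rfl | rfl⟩ <;>
    rcases Nat.even_or_odd' w with ⟨w, rfl | rfl⟩ <;> simp only [h0, if_true, if_false] <;>
    push_cast
  · exact codeAdj_even_even
  · exact codeAdj_even_odd
  · exact codeAdj_odd_even
  · exact codeAdj_odd_odd

theorem indepSum_subset {adj : ℕ → ℕ → Prop} {g : ℕ → A} {V W : Finset ℕ} (hVW : V ⊆ W)
    (hg : ∀ v ∈ W, v ∉ V → g v = 0) (w : ℂ) : indepSum adj g w V = indepSum adj g w W := by
  classical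
  refine Finset.sum_subset
    (Finset.filter_subset_filter _ (Finset.powerset_mono.2 hVW)) fun S hS hS' => ?_
  simp only [Finset.mem_filter, Finset.mem_powerset, not_and] at hS hS'
  obtain ⟨v, hv, hv'⟩ := Finset.not_subset.1 fun h => hS' h hS.2
  rw [sortProd, List.prod_eq_zero, smul_zero]
  exact List.mem_map.2 ⟨v, (Finset.mem_sort _).2 hv, hg v (hS.1 hv) hv'⟩

theorem sum_pow_smul_Q (hM : 0 ≤ M) {N : ℕ} (hN : 2 * M.toNat + 2 < N) (w : ℂ) :
    ∑ k ∈ Finset.range N, w ^ k • Q h hb M k = transfer (extGen M h hb) w M := by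
  classical
  have hV : ∀ v, v ∈ {v ∈ Finset.range (2 * M.toNat + 2) | memG M.toNat v} ↔ IsCode M v := by
    intro v
    rw [Finset.mem_filter, memG_iff_isCode hM, Finset.mem_range, and_iff_right_of_imp]
    unfold IsCode
    omega
  rw [transfer, ← indepSum_subset (V := {v ∈ Finset.range (2 * M.toNat + 2) | memG M.toNat v}),
    indepSum, ← Finset.sum_fiberwise_of_maps_to (t := Finset.range N) (g := Finset.card)]
  · refine Finset.sum_congr rfl fun k _ => ?_
    rw [Q, if_neg (by omega), if_neg (by omega), Int.toNat_natCast, Finset.smul_sum]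
    refine Finset.sum_congr ?_ fun S hS => ?_
    · ext S
      simp only [indepSets, Finset.mem_filter, Finset.mem_powerset, Indep, codeAdj_iff_adj,
        Finset.subset_iff]
      grind
    · simp only [Finset.mem_filter, Finset.mem_powerset] at hS
      rw [hS.2, sortProd, prodGen]
      congr 2
      refine List.map_congr_left fun v hv => (extGen_eq_gen ?_).symm
      exact (hV v).1 (Finset.mem_filter.2 (Finset.mem_filter.1 (hS.1.1 ((Finset.mem_sort _).1 hv))))
  · intro S hS
    rw [Finset.mem_filter, Finset.mem_powerset] at hS
    have := Finset.card_le_card (hS.1.trans (Finset.filter_subset _ _))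
    rw [Finset.card_range] at this
    rw [Finset.mem_range]
    omega
  · intro v hv
    rw [hV] at hv
    rw [mem_cliqueVertices]
    unfold IsCode at hv
    omega
  · intro v _ hv
    exact extGen_of_not_isCode (mt (hV v).2 hv)

end Extension

/-- For all integers `k, l ≥ 0` the charges mutually commute. -/
theorem charges_mutually_commute
    {A : Type*} [Ring A] [Algebra ℂ A]
    (M : ℤ) (hM : 4 ≤ M) (h hb : ℤ → A) (b bb : ℤ → ℂ)
    (hyp : FFDHyp M h hb b bb) (hac : ACRel M h hb) :
    ∀ k l : ℤ, 0 ≤ k → 0 ≤ l →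
      Q h hb M k * Q h hb M l = Q h hb M l * Q h hb M k := by
  obtain ⟨σ, hg⟩ := hyp.exists_genSystem hac
  intro k l hk hl
  lift k to ℕ using hk
  lift l to ℕ using hl
  refine commute_of_forall_sum_pow_smul (N := 2 * M.toNat + 3 + k + l)
    (c := fun k => Q h hb M k) (fun w z hwz => ?_) (by omega) (by omega)
  rw [sum_pow_smul_Q (by omega) (by omega), sum_pow_smul_Q (by omega) (by omega)]
  exact hg.transfer_comm hwz M

end FFD
end

section
/- For every m with 2 ≤ m and 2m+4 ≤ M, the following identity holds: A_{2m−1} C_{2m+2} − C_{2m} A_{2m+3} = [β_{2m+1}(1 + β_{2m+3} b_{2m+2}²) − β_{2m+3}(1 + β_{2m−1} b_{2m−2}²)] · h_{2m−3} h_{2m−1} h_{2m} h_{2m+2} h_{2m+1} h_{2m+4}. In particular, A_{2m−1} C_{2m+2} = C_{2m} A_{2m+3} whenever β_{2m+1}(1 + β_{2m+3} b_{2m+2}²) = β_{2m+3}(1 + β_{2m−1} b_{2m−2}²). -/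
namespace FFDBeta

variable {A : Type*} [Ring A] [Algebra ℂ A]

/-- The composite generator `ħ_{2m+1} = β_{2m-1} h_{2m-2} h_{2m-3} h_{2m}`
(parameterized by `m`). -/
def hbar (h : ℤ → A) (β : ℤ → ℂ) (m : ℤ) : A :=
  β (2 * m - 1) • (h (2 * m - 2) * h (2 * m - 3) * h (2 * m))

/-- `A_{2m-1} = h_{2m} h_{2m-3} + h_{2m-2} ħ_{2m+1}`. -/
def AOp (h : ℤ → A) (β : ℤ → ℂ) (m : ℤ) : A :=
  h (2 * m) * h (2 * m - 3) + h (2 * m - 2) * hbar h β m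

/-- `C_{2m} = h_{2m-3} ħ_{2m+3}`. -/
def COp (h : ℤ → A) (β : ℤ → ℂ) (m : ℤ) : A :=
  h (2 * m - 3) * hbar h β (m + 1)

/-- When `h_{2m-2}` squares to a scalar and `h_{2m-3}`, `h_{2m}` commute, `A_{2m-1}` is a scalar
multiple of `h_{2m-3} h_{2m}`. -/
theorem AOp_eq_smul {h : ℤ → A} {β : ℤ → ℂ} {m : ℤ} {c : ℂ}
    (hsq : h (2 * m - 2) * h (2 * m - 2) = c • (1 : A))
    (hcomm : h (2 * m) * h (2 * m - 3) = h (2 * m - 3) * h (2 * m)) :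
    AOp h β m = (1 + β (2 * m - 1) * c) • (h (2 * m - 3) * h (2 * m)) := by
  simp only [AOp, hbar, hcomm, mul_smul_comm, ← mul_assoc, hsq, smul_mul_assoc, one_mul, smul_smul,
    add_smul, one_smul]

/-- The identity
`A_{2m-1} C_{2m+2} - C_{2m} A_{2m+3} =
 [β_{2m+1}(1 + β_{2m+3} b_{2m+2}²) - β_{2m+3}(1 + β_{2m-1} b_{2m-2}²)]
   h_{2m-3} h_{2m-1} h_{2m} h_{2m+2} h_{2m+1} h_{2m+4}`,
and in particular `A_{2m-1} C_{2m+2} = C_{2m} A_{2m+3}` whenever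
`β_{2m+1}(1 + β_{2m+3} b_{2m+2}²) = β_{2m+3}(1 + β_{2m-1} b_{2m-2}²)`. -/
theorem ac_minus_ca_identity
    {A : Type*} [Ring A] [Algebra ℂ A]
    (M : ℤ) (hM : 8 ≤ M) (h : ℤ → A) (b β : ℤ → ℂ)
    (hsq : ∀ m : ℤ, 1 ≤ m → m ≤ M → h m * h m = (b m) ^ 2 • (1 : A))
    (hanti : ∀ m l : ℤ, 1 ≤ m → m ≤ M → 1 ≤ l → l ≤ M → 1 ≤ |m - l| → |m - l| ≤ 2 →
      h m * h l = -(h l * h m))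
    (hcomm : ∀ m l : ℤ, 1 ≤ m → m ≤ M → 1 ≤ l → l ≤ M → 2 < |m - l| →
      h m * h l = h l * h m) :
    ∀ m : ℤ, 2 ≤ m → 2 * m + 4 ≤ M →
      (AOp h β m * COp h β (m + 1) - COp h β m * AOp h β (m + 2)
        = (β (2 * m + 1) * (1 + β (2 * m + 3) * (b (2 * m + 2)) ^ 2)
            - β (2 * m + 3) * (1 + β (2 * m - 1) * (b (2 * m - 2)) ^ 2))
          • (h (2 * m - 3) * h (2 * m - 1) * h (2 * m) * h (2 * m + 2)
              * h (2 * m + 1) * h (2 * m + 4))) ∧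
      (β (2 * m + 1) * (1 + β (2 * m + 3) * (b (2 * m + 2)) ^ 2)
          = β (2 * m + 3) * (1 + β (2 * m - 1) * (b (2 * m - 2)) ^ 2) →
        AOp h β m * COp h β (m + 1) = COp h β m * AOp h β (m + 2)) := by
  intro m hm hmM
  have comm_of_sub : ∀ i j : ℤ, 1 ≤ j → j + 3 = i → i ≤ M → h i * h j = h j * h i := by
    intro i j hj hij hi
    refine hcomm i j (by omega) hi hj (by omega) ?_
    rw [show i - j = 3 by omega]
    norm_num
  have hA : AOp h β m
      = (1 + β (2 * m - 1) * b (2 * m - 2) ^ 2) • (h (2 * m - 3) * h (2 * m)) :=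
    AOp_eq_smul (hsq _ (by omega) (by omega)) (comm_of_sub _ _ (by omega) (by ring) (by omega))
  have hA' : AOp h β (m + 2)
      = (1 + β (2 * m + 3) * b (2 * m + 2) ^ 2) • (h (2 * m + 1) * h (2 * m + 4)) := by
    rw [AOp_eq_smul (hsq _ (by omega) (by omega))
      (comm_of_sub _ _ (by omega) (by ring) (by omega))]
    ring_nf
  have hC : COp h β m
      = β (2 * m + 1) • (h (2 * m - 3) * (h (2 * m) * h (2 * m - 1) * h (2 * m + 2))) := by
    rw [COp, hbar, mul_smul_comm, show 2 * (m + 1) - 1 = 2 * m + 1 by ring,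
      show 2 * (m + 1) - 2 = 2 * m by ring, show 2 * (m + 1) - 3 = 2 * m - 1 by ring,
      show 2 * (m + 1) = 2 * m + 2 by ring]
  have hC' : COp h β (m + 1)
      = β (2 * m + 3) • (h (2 * m - 1) * (h (2 * m + 2) * h (2 * m + 1) * h (2 * m + 4))) := by
    rw [COp, hbar, mul_smul_comm, show 2 * (m + 1) - 3 = 2 * m - 1 by ring,
      show 2 * (m + 1 + 1) - 1 = 2 * m + 3 by ring,
      show 2 * (m + 1 + 1) - 2 = 2 * m + 2 by ring,
      show 2 * (m + 1 + 1) - 3 = 2 * m + 1 by ring, show 2 * (m + 1 + 1) = 2 * m + 4 by ring]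
  have hswap : h (2 * m - 1) * h (2 * m) = -(h (2 * m) * h (2 * m - 1)) := by
    apply hanti <;> first | omega | (rw [show 2 * m - 1 - 2 * m = -1 by ring]; norm_num)
  have key : AOp h β m * COp h β (m + 1) - COp h β m * AOp h β (m + 2)
      = (β (2 * m + 1) * (1 + β (2 * m + 3) * (b (2 * m + 2)) ^ 2)
          - β (2 * m + 3) * (1 + β (2 * m - 1) * (b (2 * m - 2)) ^ 2))
        • (h (2 * m - 3) * h (2 * m - 1) * h (2 * m) * h (2 * m + 2)
            * h (2 * m + 1) * h (2 * m + 4)) := by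
    rw [hA, hA', hC, hC', mul_assoc (h (2 * m - 3)) (h (2 * m - 1)), hswap]
    simp only [smul_mul_smul_comm, mul_neg, neg_mul, smul_neg, mul_assoc]
    module
  refine ⟨key, fun hβ => ?_⟩
  rwa [hβ, sub_self, zero_smul, sub_eq_zero] at key

end FFDBeta
end
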